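/- Fix integers d ≥ 2 and n with 2 ≤ n ≤ 2(d−1). Then for every ε > 0 there exists Q₀ such that for every prime power q ≥ Q₀, every finite field F_q with q elements, and every squarefree monic polynomial Q ∈ F_q[t] of degree d: | Var_Q(S_{d_2,n,Q}) / (q^n / q^d) − L | < ε, where L = Pol_3(n) if n ≤ d−1 and L = Pol_3(2(d−1)−n) if d ≤ n ≤ 2(d−1), with Pol_3(x) = (x+1)(x+2)(x+3)/6. -/

import Mathlib

open Polynomial

/-- The `k`-th divisor function of a polynomial: the number of `k`-tuples of monic
polynomials whose product is `f`. -/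
noncomputable def dpoly (F : Type) [Field F] (k : ℕ) (f : Polynomial F) : ℕ :=
  Set.ncard {t : Fin k → Polynomial F | (∀ i, (t i).Monic) ∧ ∏ i, t i = f}

/-- The monic polynomial `X^n + ∑_{i<n} aᵢ X^i`; as `a` ranges over `Fin n → F`, this
ranges bijectively over all monic polynomials of degree `n`. -/
noncomputable def monicOf (F : Type) [Field F] (n : ℕ) (a : Fin n → F) : Polynomial F :=
  Polynomial.X ^ n + ∑ i : Fin n, Polynomial.C (a i) * Polynomial.X ^ (i : ℕ)

/-- The sum `N_{d_k}(A;h) = ∑_{f ∈ I(A;h)} d_k(f)` of the `k`-th divisor function over the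
short interval `I(A;h) = {f : deg(f - A) ≤ h}`, parametrized as `f = A + ∑_{i ≤ h} gᵢ X^i`. -/
noncomputable def Nshort (F : Type) [Field F] [Fintype F] (k h : ℕ) (A : Polynomial F) : ℕ :=
  ∑ g : Fin (h + 1) → F,
    dpoly F k (A + ∑ i : Fin (h + 1), Polynomial.C (g i) * Polynomial.X ^ (i : ℕ))
open scoped Classical

/-- The sum `S_{d_k,n,Q}(A) = ∑_{f ∈ M_n, f ≡ A mod Q} d_k(f)` of the `k`-th divisor function
over monic polynomials of degree `n` in the arithmetic progression `A mod Q`. -/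
noncomputable def Sap (F : Type) [Field F] [Fintype F] (k n : ℕ) (Q A : Polynomial F) : ℝ :=
  ∑ a ∈ Finset.univ.filter (fun a : Fin n → F => Q ∣ (monicOf F n a - A)),
    (dpoly F k (monicOf F n a) : ℝ)

/-- The polynomial `∑_{i<d} bᵢ X^i` of degree `< d`; as `b` ranges over `Fin d → F`, this
ranges bijectively over the residues modulo a polynomial `Q` of degree `d`. -/
noncomputable def resPoly (F : Type) [Field F] (d : ℕ) (b : Fin d → F) : Polynomial F :=
  ∑ i : Fin d, Polynomial.C (b i) * Polynomial.X ^ (i : ℕ)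

/-- The residues modulo `Q` (a polynomial of degree `d`) that are coprime to `Q`,
represented by polynomials of degree `< d`.  Its cardinality is `Φ(Q)`. -/
noncomputable def residues (F : Type) [Field F] [Fintype F] (d : ℕ) (Q : Polynomial F) :
    Finset (Fin d → F) :=
  Finset.univ.filter fun b => IsCoprime (resPoly F d b) Q

/-- The mean `⟨S_{d_k,n,Q}⟩ = Φ(Q)⁻¹ ∑_{A mod Q, (A,Q)=1} S_{d_k,n,Q}(A)`. -/
noncomputable def meanSap (F : Type) [Field F] [Fintype F] (k n d : ℕ) (Q : Polynomial F) : ℝ :=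
  (1 / ((residues F d Q).card : ℝ)) * ∑ b ∈ residues F d Q, Sap F k n Q (resPoly F d b)

/-- The variance `Var_Q(S_{d_k,n,Q}) = Φ(Q)⁻¹ ∑_{A mod Q, (A,Q)=1} |S_{d_k,n,Q}(A) - ⟨S⟩|²`. -/
noncomputable def VarAP (F : Type) [Field F] [Fintype F] (k n d : ℕ) (Q : Polynomial F) : ℝ :=
  (1 / ((residues F d Q).card : ℝ)) *
    ∑ b ∈ residues F d Q, (Sap F k n Q (resPoly F d b) - meanSap F k n d Q) ^ 2

/-- The cubic polynomial `Pol₃(x) = (x+1)(x+2)(x+3)/6`. -/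
noncomputable def Pol3 (x : ℝ) : ℝ := (x + 1) * (x + 2) * (x + 3) / 6

open Finset.HasAntidiagonal (antidiagonal mem_antidiagonal)
open scoped ComplexConjugate

section Characters

variable {R : Type*} [CommRing R] [Fintype R]

noncomputable instance MulChar.instFintypeComplex : Fintype (MulChar R ℂ) := Fintype.ofFinite _

theorem card_filter_isUnit : (Finset.univ.filter fun b : R => IsUnit b).card = Fintype.card Rˣ := by
  rw [← Finset.card_univ, ← Finset.card_image_of_injective _ (Units.val_injective (α := R))]
  congr 1
  ext b
  simp only [Finset.mem_filter, Finset.mem_univ, true_and, Finset.mem_image]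
  rfl

theorem MulChar.sum_apply_eq_ite (a : R) :
    ∑ χ : MulChar R ℂ, χ a = if a = 1 then (Fintype.card Rˣ : ℂ) else 0 := by
  split_ifs with ha
  · have h := MulChar.card_eq_card_units_of_hasEnoughRootsOfUnity R ℂ
    rw [Nat.card_eq_fintype_card, Nat.card_eq_fintype_card] at h
    simp [ha, h]
  · obtain ⟨χ, hχ⟩ := MulChar.exists_apply_ne_one_of_hasEnoughRootsOfUnity R ℂ ha
    refine eq_zero_of_mul_eq_self_left hχ ?_
    simp only [Finset.mul_sum, ← MulChar.mul_apply]
    exact Fintype.sum_bijective _ (Group.mulLeft_bijective χ) _ _ fun χ' ↦ rfl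

theorem MulChar.conj_apply (χ : MulChar R ℂ) (a : R) : conj (χ a) = χ⁻¹ a :=
  χ.star_apply' a

theorem MulChar.conj_apply_unit (χ : MulChar R ℂ) (u : Rˣ) : conj (χ u) = χ ↑u⁻¹ := by
  rw [χ.conj_apply, MulChar.inv_apply, Ring.inverse_unit]

theorem MulChar.norm_apply_unit (χ : MulChar R ℂ) (u : Rˣ) : ‖χ u‖ = 1 := by
  have h : χ u * conj (χ u) = 1 := by
    rw [χ.conj_apply_unit, ← map_mul, Units.mul_inv, map_one]
  rw [Complex.mul_conj, Complex.normSq_eq_norm_sq] at h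
  have h2 : ‖χ (u : R)‖ ^ 2 = 1 := by exact_mod_cast h
  exact (pow_eq_one_iff_of_nonneg (norm_nonneg _) two_ne_zero).1 h2

theorem MulChar.norm_apply_le_one (χ : MulChar R ℂ) (a : R) : ‖χ a‖ ≤ 1 := by
  by_cases ha : IsUnit a
  · obtain ⟨u, rfl⟩ := ha
    exact (χ.norm_apply_unit u).le
  · simp [χ.map_nonunit ha]

theorem MulChar.sum_apply_mul_conj (c x y : R) (hc : IsUnit c) :
    ∑ χ : MulChar R ℂ, χ c * χ x * conj (χ y) =
      if IsUnit x ∧ c * x = y then (Fintype.card Rˣ : ℂ) else 0 := by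
  by_cases hy : IsUnit y
  · obtain ⟨u, rfl⟩ := hy
    simp_rw [MulChar.conj_apply_unit, ← map_mul, MulChar.sum_apply_eq_ite]
    refine if_congr ?_ rfl rfl
    rw [Units.mul_inv_eq_one]
    refine ⟨fun h => ⟨?_, h⟩, fun h => h.2⟩
    exact isUnit_of_mul_isUnit_right (h ▸ u.isUnit)
  · rw [if_neg]
    · simp [MulChar.map_nonunit _ hy]
    · rintro ⟨h1, rfl⟩
      exact hy (hc.mul h1)

/-- Twisted Parseval identity for the multiplicative characters of a finite ring. -/
theorem MulChar.sum_apply_mul_transform_mul_conj (S : R → ℝ) (c : R) (hc : IsUnit c) :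
    ∑ χ : MulChar R ℂ, χ c * ((∑ x, (S x : ℂ) * χ x) * conj (∑ x, (S x : ℂ) * χ x)) =
      (Fintype.card Rˣ : ℂ) * ∑ x with IsUnit x, (S x : ℂ) * S (c * x) := by
  have h : ∀ χ : MulChar R ℂ,
      χ c * ((∑ x, (S x : ℂ) * χ x) * conj (∑ x, (S x : ℂ) * χ x)) =
      ∑ x, ∑ y, (S x : ℂ) * S y * (χ c * χ x * conj (χ y)) := by
    intro χ
    rw [map_sum, Finset.sum_mul_sum, Finset.mul_sum]
    refine Finset.sum_congr rfl fun x _ => ?_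
    rw [Finset.mul_sum]
    refine Finset.sum_congr rfl fun y _ => ?_
    rw [map_mul, Complex.conj_ofReal]
    ring
  simp_rw [h]
  rw [Finset.sum_comm, Finset.mul_sum, Finset.sum_filter]
  refine Finset.sum_congr rfl fun x _ => ?_
  rw [Finset.sum_comm]
  simp_rw [← Finset.mul_sum, MulChar.sum_apply_mul_conj c x _ hc]
  by_cases hx : IsUnit x
  · simp only [hx, true_and, if_true]
    simp only [mul_ite, mul_zero, Finset.sum_ite_eq, Finset.mem_univ, if_true]
    ring
  · simp [hx]

theorem MulChar.sum_norm_transform_sq (S : R → ℝ) :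
    ∑ χ : MulChar R ℂ, ‖∑ x, (S x : ℂ) * χ x‖ ^ 2 =
      (Fintype.card Rˣ : ℝ) * ∑ x with IsUnit x, S x ^ 2 := by
  have h := MulChar.sum_apply_mul_transform_mul_conj S 1 isUnit_one
  simp only [map_one, one_mul, Complex.mul_conj, Complex.normSq_eq_norm_sq] at h
  have : ((∑ χ : MulChar R ℂ, ‖∑ x, (S x : ℂ) * χ x‖ ^ 2 : ℝ) : ℂ) =
      ((Fintype.card Rˣ : ℝ) * ∑ x with IsUnit x, S x ^ 2 : ℝ) := by
    push_cast at h ⊢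
    rw [h]
    simp [sq]
  exact_mod_cast this

/-- A Gauss sum that vanishes on the non-invertible frequencies has absolute value `√|R|`. -/
theorem norm_gaussSum_sq_of_separable {χ : MulChar R ℂ} {ψ : AddChar R ℂ} (hψ : ψ.IsPrimitive)
    (hχ : ∀ b, ¬IsUnit b → gaussSum χ (ψ.mulShift b) = 0) :
    ‖gaussSum χ ψ‖ ^ 2 = Fintype.card R := by
  have hconj : ∀ a, conj (ψ a) = ψ (-a) := fun a => (AddChar.map_neg_eq_conj ψ a).symm
  have h1 : ∑ b, gaussSum χ (ψ.mulShift b) * conj (gaussSum χ (ψ.mulShift b)) =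
      (Fintype.card R : ℂ) * Fintype.card Rˣ := by
    have h : ∀ b, gaussSum χ (ψ.mulShift b) * conj (gaussSum χ (ψ.mulShift b)) =
        ∑ x, ∑ y, χ x * conj (χ y) * ψ (b * (x - y)) := by
      intro b
      rw [gaussSum, map_sum, Finset.sum_mul_sum]
      refine Finset.sum_congr rfl fun x _ => Finset.sum_congr rfl fun y _ => ?_
      rw [map_mul, AddChar.mulShift_apply, AddChar.mulShift_apply, hconj, mul_sub, sub_eq_add_neg,
        AddChar.map_add_eq_mul]
      ring
    simp_rw [h]
    rw [Finset.sum_comm]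
    have h2 : ∀ x, ∑ b, ∑ y, χ x * conj (χ y) * ψ (b * (x - y)) =
        (Fintype.card R : ℂ) * (χ x * conj (χ x)) := by
      intro x
      rw [Finset.sum_comm]
      simp_rw [← Finset.mul_sum, AddChar.sum_mulShift _ hψ, sub_eq_zero]
      simp [mul_comm]
    simp_rw [h2, ← Finset.mul_sum]
    congr 1
    rw [← MulChar.sum_one_eq_card_units (R := R) (R' := ℂ)]
    refine Finset.sum_congr rfl fun x _ => ?_
    rw [χ.conj_apply, ← MulChar.mul_apply, mul_inv_cancel]
  have h3 : ∀ b, gaussSum χ (ψ.mulShift b) * conj (gaussSum χ (ψ.mulShift b)) =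
      if IsUnit b then (‖gaussSum χ ψ‖ ^ 2 : ℂ) else 0 := by
    intro b
    split_ifs with hb
    · obtain ⟨u, rfl⟩ := hb
      have h4 := gaussSum_mulShift χ ψ u
      rw [Complex.mul_conj, Complex.normSq_eq_norm_sq, ← h4, norm_mul, χ.norm_apply_unit, one_mul]
      push_cast
      rfl
    · rw [hχ b hb, zero_mul]
  simp_rw [h3] at h1
  rw [Finset.sum_ite, Finset.sum_const_zero, add_zero, Finset.sum_const, nsmul_eq_mul] at h1
  rw [card_filter_isUnit, mul_comm] at h1
  have h6 : (Fintype.card Rˣ : ℂ) ≠ 0 := Nat.cast_ne_zero.2 Fintype.card_ne_zero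
  exact_mod_cast mul_right_cancel₀ h6 h1

end Characters

section Polynomials

variable {F : Type} [Field F]

theorem coeff_resPoly (n : ℕ) (b : Fin n → F) (k : ℕ) :
    (resPoly F n b).coeff k = if h : k < n then b ⟨k, h⟩ else 0 := by
  simp only [resPoly, finsetSum_coeff, coeff_C_mul, coeff_X_pow, mul_ite, mul_one, mul_zero]
  split_ifs with h
  · rw [Finset.sum_eq_single ⟨k, h⟩]
    · simp
    · intro i _ hi
      rw [if_neg]
      rintro rfl
      exact hi rfl
    · simp
  · refine Finset.sum_eq_zero fun i _ => if_neg ?_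
    rintro rfl
    exact h i.2

theorem resPoly_injective (n : ℕ) : Function.Injective (resPoly F n) := by
  intro a b h
  ext i
  have := congrArg (fun p => p.coeff (i : ℕ)) h
  simpa [coeff_resPoly] using this

theorem monicOf_injective (n : ℕ) : Function.Injective (monicOf F n) := fun _ _ h =>
  resPoly_injective n (add_left_cancel h)

theorem degree_resPoly_lt (n : ℕ) (b : Fin n → F) : (resPoly F n b).degree < n := by
  rw [degree_lt_iff_coeff_zero]
  intro m hm
  rw [coeff_resPoly, dif_neg (by omega)]

/-- The monic irreducible factors of `B`. -/
noncomputable def primeFactorsFinset (B : F[X]) : Finset F[X] :=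
  (UniqueFactorizationMonoid.normalizedFactors B).toFinset

theorem mem_primeFactorsFinset {B P : F[X]} (hB : B ≠ 0) :
    P ∈ primeFactorsFinset B ↔ P.Monic ∧ Irreducible P ∧ P ∣ B := by
  rw [primeFactorsFinset, Multiset.mem_toFinset,
    UniqueFactorizationMonoid.mem_normalizedFactors_iff' hB]
  constructor
  · rintro ⟨h1, h2, h3⟩
    exact ⟨h2 ▸ monic_normalize h1.ne_zero, h1, h3⟩
  · rintro ⟨h1, h2, h3⟩
    exact ⟨h2, h1.normalize_eq_self, h3⟩

theorem card_primeFactorsFinset_le {B : F[X]} (hB : B.Monic) :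
    (primeFactorsFinset B).card ≤ B.natDegree := by
  refine (Multiset.toFinset_card_le _).trans ?_
  have h1 := UniqueFactorizationMonoid.prod_normalizedFactors_eq hB.ne_zero
  rw [hB.normalize_eq_self] at h1
  conv_rhs => rw [← h1]
  rw [natDegree_multiset_prod _ (UniqueFactorizationMonoid.zero_notMem_normalizedFactors B)]
  have h2 := Multiset.card_nsmul_le_sum (s :=
    (UniqueFactorizationMonoid.normalizedFactors B).map natDegree) (a := 1) ?_
  · simpa using h2
  · intro x hx
    rw [Multiset.mem_map] at hx
    obtain ⟨P, hP, rfl⟩ := hx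
    exact (UniqueFactorizationMonoid.irreducible_of_normalized_factor P hP).natDegree_pos

theorem exists_primeFactor_dvd_of_not_isCoprime {B f : F[X]} (hB : B ≠ 0) (h : ¬IsCoprime f B) :
    ∃ P ∈ primeFactorsFinset B, P ∣ f := by
  by_contra! hc
  refine h (isCoprime_of_irreducible_dvd (fun h => hB h.2) ?_)
  intro z hz hzf hzB
  refine hc (normalize z) ?_ (normalize_dvd_iff.2 hzf)
  rw [mem_primeFactorsFinset hB]
  refine ⟨monic_normalize hz.ne_zero, ?_, normalize_dvd_iff.2 hzB⟩
  exact (normalize_associated z).symm.irreducible hz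

theorem AdjoinRoot.isUnit_mk_iff {Q f : F[X]} :
    IsUnit (AdjoinRoot.mk Q f) ↔ IsCoprime f Q := by
  rw [isUnit_iff_exists_inv]
  constructor
  · rintro ⟨b, hb⟩
    induction b using AdjoinRoot.induction_on with | ih g => ?_
    rw [← map_mul, ← map_one (AdjoinRoot.mk Q), AdjoinRoot.mk_eq_mk] at hb
    obtain ⟨c, hc⟩ := hb
    exact ⟨g, -c, by linear_combination hc⟩
  · rintro ⟨a, b, h⟩
    refine ⟨AdjoinRoot.mk Q a, ?_⟩
    rw [← map_mul, ← map_one (AdjoinRoot.mk Q), AdjoinRoot.mk_eq_mk]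
    exact ⟨-b, by linear_combination h⟩

theorem eq_of_mk_eq_mk {Q f g : F[X]} (h : AdjoinRoot.mk Q f = AdjoinRoot.mk Q g)
    (hd : (f - g).degree < Q.degree) : f = g := by
  rw [AdjoinRoot.mk_eq_mk] at h
  exact sub_eq_zero.1 (eq_zero_of_dvd_of_degree_lt h hd)

variable [Fintype F]

variable (F) in
/-- The polynomials of degree less than `n`. -/
noncomputable def lowDegree (n : ℕ) : Finset F[X] := Finset.univ.image (resPoly F n)

theorem mem_lowDegree {n : ℕ} {f : F[X]} : f ∈ lowDegree F n ↔ f.degree < n := by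
  simp only [lowDegree, Finset.mem_image, Finset.mem_univ, true_and]
  constructor
  · rintro ⟨b, rfl⟩
    exact degree_resPoly_lt n b
  · intro h
    refine ⟨fun i => f.coeff i, ?_⟩
    ext k
    rw [coeff_resPoly]
    split_ifs with hk
    · rfl
    · exact (((degree_lt_iff_coeff_zero f n).1 h) k (by omega)).symm

theorem card_lowDegree (n : ℕ) : (lowDegree F n).card = Fintype.card F ^ n := by
  rw [lowDegree, Finset.card_image_of_injective _ (resPoly_injective n)]
  simp

variable (F) in
/-- The monic polynomials of degree `n`. -/
noncomputable def monics (n : ℕ) : Finset F[X] := Finset.univ.image (monicOf F n)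

theorem sum_monics {M : Type*} [AddCommMonoid M] (n : ℕ) (g : F[X] → M) :
    ∑ f ∈ monics F n, g f = ∑ a, g (monicOf F n a) :=
  Finset.sum_image fun _ _ _ _ h => monicOf_injective n h

theorem monics_eq_image_lowDegree (n : ℕ) :
    monics F n = (lowDegree F n).image fun f => X ^ n + f := by
  rw [monics, lowDegree, Finset.image_image]
  rfl

theorem mem_monics_iff_sub {n : ℕ} {f : F[X]} :
    f ∈ monics F n ↔ (f - X ^ n).degree < (n : WithBot ℕ) := by
  rw [monics_eq_image_lowDegree, Finset.mem_image]
  constructor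
  · rintro ⟨g, hg, rfl⟩
    simpa using mem_lowDegree.1 hg
  · exact fun h => ⟨f - X ^ n, mem_lowDegree.2 h, by ring⟩

theorem mem_monics {n : ℕ} {f : F[X]} : f ∈ monics F n ↔ f.Monic ∧ f.natDegree = n := by
  rw [mem_monics_iff_sub]
  constructor
  · intro h
    have e : f = X ^ n + (f - X ^ n) := by ring
    have hm : f.Monic := by
      rw [e]
      exact monic_X_pow_add h
    refine ⟨hm, ?_⟩
    rw [e, natDegree_add_eq_left_of_degree_lt (by simpa using h), natDegree_X_pow]
  · rintro ⟨hm, rfl⟩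
    have h := degree_sub_lt_left (p := f) (q := X ^ f.natDegree)
      (by rw [degree_X_pow, degree_eq_natDegree hm.ne_zero]) hm.ne_zero (by simp [hm.leadingCoeff])
    rwa [degree_eq_natDegree hm.ne_zero] at h

theorem card_monics (n : ℕ) : (monics F n).card = Fintype.card F ^ n := by
  rw [monics, Finset.card_image_of_injective _ (monicOf_injective n)]
  simp

theorem Polynomial.Monic.mem_monics {f : F[X]} (hf : f.Monic) : f ∈ monics F f.natDegree :=
  _root_.mem_monics.2 ⟨hf, rfl⟩

theorem mul_mem_monics {i j : ℕ} {f g : F[X]} (hf : f ∈ monics F i) (hg : g ∈ monics F j) :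
    f * g ∈ monics F (i + j) := by
  rw [mem_monics] at *
  exact ⟨hf.1.mul hg.1, by rw [hf.1.natDegree_mul hg.1, hf.2, hg.2]⟩

theorem filter_dvd_monics {P : F[X]} (hP : P.Monic) {n : ℕ} (hn : P.natDegree ≤ n) :
    (monics F n).filter (P ∣ ·) = (monics F (n - P.natDegree)).image (P * ·) := by
  ext f
  simp only [Finset.mem_filter, Finset.mem_image]
  constructor
  · rintro ⟨hf, g, rfl⟩
    rw [mem_monics] at hf
    have hg : g.Monic := hP.of_mul_monic_left hf.1
    refine ⟨g, mem_monics.2 ⟨hg, ?_⟩, rfl⟩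
    rw [← hf.2, hP.natDegree_mul hg]
    omega
  · rintro ⟨g, hg, rfl⟩
    refine ⟨?_, dvd_mul_right _ _⟩
    have := mul_mem_monics hP.mem_monics hg
    rwa [Nat.add_sub_cancel' hn] at this

theorem filter_dvd_monics_eq_empty {P : F[X]} {n : ℕ} (hn : n < P.natDegree) :
    (monics F n).filter (P ∣ ·) = ∅ := by
  rw [Finset.filter_eq_empty_iff]
  intro f hf h
  rw [mem_monics] at hf
  have := natDegree_le_of_dvd h hf.1.ne_zero
  omega

theorem card_mul_card_not_isCoprime_le {B : F[X]} (hB : B.Monic) (n : ℕ) :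
    Fintype.card F * ((monics F n).filter fun f => ¬IsCoprime f B).card ≤
      B.natDegree * Fintype.card F ^ n := by
  have h1 : (monics F n).filter (fun f => ¬IsCoprime f B) ⊆
      (primeFactorsFinset B).biUnion fun P => (monics F n).filter (P ∣ ·) := by
    intro f hf
    rw [Finset.mem_filter] at hf
    obtain ⟨P, hP, hPf⟩ := exists_primeFactor_dvd_of_not_isCoprime hB.ne_zero hf.2
    exact Finset.mem_biUnion.2 ⟨P, hP, Finset.mem_filter.2 ⟨hf.1, hPf⟩⟩
  calc _ ≤ Fintype.card F * ∑ P ∈ primeFactorsFinset B, ((monics F n).filter (P ∣ ·)).card :=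
        Nat.mul_le_mul_left _ ((Finset.card_le_card h1).trans Finset.card_biUnion_le)
    _ = ∑ P ∈ primeFactorsFinset B, Fintype.card F * ((monics F n).filter (P ∣ ·)).card :=
        Finset.mul_sum _ _ _
    _ ≤ ∑ P ∈ primeFactorsFinset B, Fintype.card F ^ n := by
        refine Finset.sum_le_sum fun P hP => ?_
        rw [mem_primeFactorsFinset hB.ne_zero] at hP
        rcases le_or_gt P.natDegree n with h | h
        · rw [filter_dvd_monics hP.1 h, Finset.card_image_of_injective _
            (mul_right_injective₀ hP.1.ne_zero), card_monics, ← pow_succ']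
          have := hP.2.1.natDegree_pos
          exact Nat.pow_le_pow_right Fintype.card_pos (by omega)
        · rw [filter_dvd_monics_eq_empty h]
          simp
    _ ≤ _ := by
        rw [Finset.sum_const, smul_eq_mul]
        exact Nat.mul_le_mul_right _ (card_primeFactorsFinset_le hB)

theorem injOn_mk_monics {Q : F[X]} (hQ : Q.Monic) {n : ℕ} (hn : n ≤ Q.natDegree) :
    Set.InjOn (AdjoinRoot.mk Q) (monics F n) := by
  intro f hf g hg h
  refine eq_of_mk_eq_mk h ?_
  rw [Finset.mem_coe, mem_monics_iff_sub] at hf hg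
  rw [degree_eq_natDegree hQ.ne_zero]
  have : f - g = (f - X ^ n) - (g - X ^ n) := by ring
  rw [this]
  refine (degree_sub_le _ _).trans_lt ((max_lt hf hg).trans_le ?_)
  exact_mod_cast hn

theorem injOn_mk_lowDegree {Q : F[X]} (hQ : Q.Monic) {n : ℕ} (hn : n ≤ Q.natDegree) :
    Set.InjOn (AdjoinRoot.mk Q) (lowDegree F n) := by
  intro f hf g hg h
  refine eq_of_mk_eq_mk h ?_
  rw [Finset.mem_coe, mem_lowDegree] at hf hg
  rw [degree_eq_natDegree hQ.ne_zero]
  refine (degree_sub_le _ _).trans_lt ((max_lt hf hg).trans_le ?_)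
  exact_mod_cast hn

theorem exists_mem_lowDegree_mk_eq {Q : F[X]} (hQ : Q.Monic) (x : AdjoinRoot Q) :
    ∃ f ∈ lowDegree F Q.natDegree, AdjoinRoot.mk Q f = x := by
  induction x using AdjoinRoot.induction_on with | ih g => ?_
  refine ⟨g %ₘ Q, mem_lowDegree.2 ?_, ?_⟩
  · rw [← degree_eq_natDegree hQ.ne_zero]
    exact degree_modByMonic_lt _ hQ
  · rw [AdjoinRoot.mk_eq_mk]
    exact ⟨-(g /ₘ Q), by linear_combination modByMonic_add_div g Q⟩

instance AdjoinRoot.finite_of_monic {Q : F[X]} [hQ : Fact Q.Monic] : Finite (AdjoinRoot Q) := by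
  refine Finite.of_surjective (fun f : lowDegree F Q.natDegree => AdjoinRoot.mk Q f) fun x => ?_
  obtain ⟨f, hf, h⟩ := exists_mem_lowDegree_mk_eq hQ.out x
  exact ⟨⟨f, hf⟩, h⟩

noncomputable instance AdjoinRoot.fintype_of_monic {Q : F[X]} [Fact Q.Monic] :
    Fintype (AdjoinRoot Q) := Fintype.ofFinite _

theorem sum_lowDegree_mk {M : Type*} [AddCommMonoid M] {Q : F[X]} [hQ : Fact Q.Monic]
    (g : AdjoinRoot Q → M) :
    ∑ f ∈ lowDegree F Q.natDegree, g (AdjoinRoot.mk Q f) = ∑ x, g x := by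
  rw [← Finset.sum_image (f := g) (injOn_mk_lowDegree hQ.out le_rfl)]
  congr 1
  ext x
  simpa using exists_mem_lowDegree_mk_eq hQ.out x

theorem sum_monics_mk {M : Type*} [AddCommMonoid M] {Q : F[X]} [hQ : Fact Q.Monic]
    (g : AdjoinRoot Q → M) :
    ∑ f ∈ monics F Q.natDegree, g (AdjoinRoot.mk Q f) = ∑ x, g x := by
  rw [monics_eq_image_lowDegree, Finset.sum_image (by simp)]
  simp_rw [map_add]
  rw [sum_lowDegree_mk fun y => g (AdjoinRoot.mk Q (X ^ Q.natDegree) + y)]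
  exact Fintype.sum_equiv (Equiv.addLeft (AdjoinRoot.mk Q (X ^ Q.natDegree))) _ _ fun _ => rfl

end Polynomials

section Counting

theorem sum_antidiagonal_succ_mul_succ (m : ℕ) :
    6 * ∑ p ∈ antidiagonal m, (p.1 + 1) * (p.2 + 1) = (m + 1) * (m + 2) * (m + 3) := by
  have h (n : ℕ) : 2 * ∑ p ∈ antidiagonal n, (p.2 + 1) = (n + 1) * (n + 2) := by
    induction n with
    | zero => simp
    | succ n ih =>
      rw [Finset.Nat.sum_antidiagonal_succ]
      simp only
      linarith
  induction m with
  | zero => simp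
  | succ n ih =>
    rw [Finset.Nat.sum_antidiagonal_succ]
    have e : ∑ p ∈ antidiagonal n, (p.1 + 1 + 1) * (p.2 + 1) =
        ∑ p ∈ antidiagonal n, (p.1 + 1) * (p.2 + 1) +
          ∑ p ∈ antidiagonal n, (p.2 + 1) := by
      rw [← Finset.sum_add_distrib]
      exact Finset.sum_congr rfl fun p _ => by ring
    rw [e]
    have := h n
    simp only
    linarith

section Field

variable {F : Type} [Field F]

theorem exists_monic_factorization_of_mul_eq_mul {f g h k : F[X]} (hf : f.Monic)
    (hh : h.Monic) (hk : k.Monic) (he : f * g = h * k) :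
    ∃ a b c e : F[X], a.Monic ∧ b.Monic ∧ c.Monic ∧ e.Monic ∧
      f = a * b ∧ g = c * e ∧ h = a * c ∧ k = b * e := by
  obtain ⟨a, b, ⟨c, rfl⟩, ⟨e, rfl⟩, rfl⟩ := exists_dvd_and_dvd_of_dvd_mul (Dvd.intro g he)
  have ha0 : a ≠ 0 := left_ne_zero_of_mul hf.ne_zero
  have hb0 : b ≠ 0 := right_ne_zero_of_mul hf.ne_zero
  have hlc : a.leadingCoeff ≠ 0 := leadingCoeff_ne_zero.2 ha0
  have hC : (C a.leadingCoeff⁻¹ * C a.leadingCoeff : F[X]) = 1 := by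
    rw [← C_mul, inv_mul_cancel₀ hlc, C_1]
  have ha : (C a.leadingCoeff⁻¹ * a).Monic := by
    rw [mul_comm]
    exact monic_mul_leadingCoeff_inv ha0
  have e1 : a * b = (C a.leadingCoeff⁻¹ * a) * (C a.leadingCoeff * b) := by
    linear_combination (-a * b) * hC
  have e2 : a * c = (C a.leadingCoeff⁻¹ * a) * (C a.leadingCoeff * c) := by
    linear_combination (-a * c) * hC
  have e3 : b * e = (C a.leadingCoeff * b) * (C a.leadingCoeff⁻¹ * e) := by
    linear_combination (-b * e) * hC
  have hb : (C a.leadingCoeff * b).Monic := ha.of_mul_monic_left (e1 ▸ hf)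
  refine ⟨_, _, _, _, ha, hb, ha.of_mul_monic_left (e2 ▸ hh),
    hb.of_mul_monic_left (e3 ▸ hk), e1, ?_, e2, e3⟩
  refine mul_left_cancel₀ (mul_ne_zero ha0 hb0) ?_
  linear_combination he - a * b * c * e * hC

theorem eq_of_mul_eq_mul_of_isCoprime {a b c a' b' c' : F[X]} (ha : a.Monic) (ha' : a'.Monic)
    (h : IsCoprime b c) (h' : IsCoprime b' c') (hb : a * b = a' * b') (hc : a * c = a' * c') :
    a = a' ∧ b = b' ∧ c = c' := by
  have key : a = a' := by
    refine eq_of_dvd_of_natDegree_le_of_leadingCoeff ?_ ?_ (by rw [ha.leadingCoeff, ha'.leadingCoeff])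
    · obtain ⟨u, v, huv⟩ := h'
      exact ⟨u * b + v * c, by linear_combination (-a') * huv - u * hb - v * hc⟩
    · refine natDegree_le_of_dvd ?_ ha.ne_zero
      obtain ⟨u, v, huv⟩ := h
      exact ⟨u * b' + v * c', by linear_combination (-a) * huv + u * hb + v * hc⟩
  subst key
  exact ⟨rfl, mul_left_cancel₀ ha.ne_zero hb, mul_left_cancel₀ ha.ne_zero hc⟩

end Field

variable {F : Type} [Field F] [Fintype F]

variable (F) in
/-- The pairs of monic polynomials whose product has degree `n`. -/
noncomputable def monicPairs (n : ℕ) : Finset (F[X] × F[X]) :=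
  (antidiagonal n).biUnion fun p => monics F p.1 ×ˢ monics F p.2

theorem mem_monicPairs {n : ℕ} {p : F[X] × F[X]} :
    p ∈ monicPairs F n ↔ p.1.Monic ∧ p.2.Monic ∧ p.1.natDegree + p.2.natDegree = n := by
  simp only [monicPairs, Finset.mem_biUnion, mem_antidiagonal, Finset.mem_product,
    mem_monics]
  constructor
  · rintro ⟨x, hx, ⟨h1, h2⟩, h3, h4⟩
    exact ⟨h1, h3, by rw [h2, h4, hx]⟩
  · rintro ⟨h1, h2, h3⟩
    exact ⟨(p.1.natDegree, p.2.natDegree), h3, ⟨h1, rfl⟩, h2, rfl⟩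

theorem mul_mem_monics_of_mem_monicPairs {n : ℕ} {p : F[X] × F[X]} (hp : p ∈ monicPairs F n) :
    p.1 * p.2 ∈ monics F n := by
  rw [mem_monicPairs] at hp
  exact mem_monics.2 ⟨hp.1.mul hp.2.1, by rw [hp.1.natDegree_mul hp.2.1, hp.2.2]⟩

theorem sum_monicPairs {M : Type*} [AddCommMonoid M] (n : ℕ) (g : F[X] × F[X] → M) :
    ∑ p ∈ monicPairs F n, g p =
      ∑ x ∈ antidiagonal n, ∑ a ∈ monics F x.1, ∑ b ∈ monics F x.2, g (a, b) := by
  rw [monicPairs, Finset.sum_biUnion]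
  · exact Finset.sum_congr rfl fun x _ => Finset.sum_product _ _ _
  · intro x _ y _ hxy
    rw [Function.onFun, Finset.disjoint_left]
    intro p hp hp'
    simp only [Finset.mem_product, mem_monics] at hp hp'
    exact hxy (Prod.ext (hp.1.2.symm.trans hp'.1.2) (hp.2.2.symm.trans hp'.2.2))

theorem card_monicPairs (n : ℕ) :
    (monicPairs F n).card = (n + 1) * Fintype.card F ^ n := by
  rw [Finset.card_eq_sum_ones, sum_monicPairs]
  rw [Finset.sum_congr rfl (g := fun _ => Fintype.card F ^ n)]
  · simp
  · intro x hx
    rw [mem_antidiagonal] at hx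
    simp [card_monics, ← pow_add, hx]

theorem dpoly_two_eq_card {n : ℕ} {f : F[X]} (hf : f ∈ monics F n) :
    dpoly F 2 f = ((monicPairs F n).filter fun p => p.1 * p.2 = f).card := by
  rw [dpoly, ← Set.ncard_coe_finset,
    ← Set.ncard_image_of_injective _ (finTwoArrowEquiv F[X]).injective]
  congr 1
  ext p
  simp only [Set.mem_image, Set.mem_ofPred_eq, Finset.coe_filter, mem_monicPairs]
  constructor
  · rintro ⟨t, ⟨h1, h2⟩, rfl⟩
    rw [Fin.prod_univ_two] at h2
    refine ⟨⟨h1 0, h1 1, ?_⟩, h2⟩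
    rw [← (mem_monics.1 hf).2, ← h2, (h1 0).natDegree_mul (h1 1)]
    rfl
  · rintro ⟨⟨h1, h2, _⟩, h3⟩
    refine ⟨![p.1, p.2], ⟨?_, ?_⟩, ?_⟩
    · intro i
      fin_cases i
      · exact h1
      · exact h2
    · simpa [Fin.prod_univ_two] using h3
    · simp [finTwoArrowEquiv]

variable (F) in
/-- The quadruples of monic polynomials whose product has degree `m`. -/
noncomputable def monicQuadruples (m : ℕ) : Finset ((F[X] × F[X]) × (F[X] × F[X])) :=
  (antidiagonal m).biUnion fun p => monicPairs F p.1 ×ˢ monicPairs F p.2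

theorem mem_monicQuadruples {m : ℕ} {w : (F[X] × F[X]) × (F[X] × F[X])} :
    w ∈ monicQuadruples F m ↔ w.1.1.Monic ∧ w.1.2.Monic ∧ w.2.1.Monic ∧ w.2.2.Monic ∧
      w.1.1.natDegree + w.1.2.natDegree + (w.2.1.natDegree + w.2.2.natDegree) = m := by
  simp only [monicQuadruples, Finset.mem_biUnion, mem_antidiagonal, Finset.mem_product,
    mem_monicPairs]
  constructor
  · rintro ⟨x, hx, ⟨h1, h2, h3⟩, h4, h5, h6⟩
    exact ⟨h1, h2, h4, h5, by rw [h3, h6, hx]⟩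
  · rintro ⟨h1, h2, h3, h4, h5⟩
    exact ⟨(_, _), h5, ⟨h1, h2, rfl⟩, h3, h4, rfl⟩

theorem sum_monicQuadruples {M : Type*} [AddCommMonoid M] (m : ℕ)
    (g : (F[X] × F[X]) × (F[X] × F[X]) → M) :
    ∑ w ∈ monicQuadruples F m, g w =
      ∑ x ∈ antidiagonal m, 
        ∑ y ∈ antidiagonal x.1, ∑ a ∈ monics F y.1, ∑ b ∈ monics F y.2,
          ∑ z ∈ antidiagonal x.2, ∑ c ∈ monics F z.1, ∑ e ∈ monics F z.2,
          g ((a, b), (c, e)) := by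
  rw [monicQuadruples, Finset.sum_biUnion]
  · refine Finset.sum_congr rfl fun x _ => ?_
    simp_rw [Finset.sum_product, sum_monicPairs]
  · intro x _ y _ hxy
    rw [Function.onFun, Finset.disjoint_left]
    intro p hp hp'
    simp only [Finset.mem_product, mem_monicPairs] at hp hp'
    exact hxy (Prod.ext (hp.1.2.2.symm.trans hp'.1.2.2) (hp.2.2.2.symm.trans hp'.2.2.2))

end Counting

section Counting

variable {F : Type} [Field F] [Fintype F]

/-- The number `(m + 1)(m + 2)(m + 3) / 6` of ordered quadruples of naturals with sum `m`. -/
def quadrupleCount (m : ℕ) : ℕ := ∑ p ∈ antidiagonal m, (p.1 + 1) * (p.2 + 1)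

theorem card_monicQuadruples (m : ℕ) :
    (monicQuadruples F m).card = quadrupleCount m * Fintype.card F ^ m := by
  rw [monicQuadruples, Finset.card_biUnion, quadrupleCount, Finset.sum_mul]
  · refine Finset.sum_congr rfl fun x hx => ?_
    rw [Finset.card_product, card_monicPairs, card_monicPairs, ← mem_antidiagonal.1 hx, pow_add]
    ring
  · intro x _ y _ hxy
    rw [Function.onFun, Finset.disjoint_left]
    intro p hp hp'
    simp only [Finset.mem_product, mem_monicPairs] at hp hp'
    exact hxy (Prod.ext (hp.1.2.2.symm.trans hp'.1.2.2) (hp.2.2.2.symm.trans hp'.2.2.2))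

variable (F) in
/-- The solutions of `f * g = h * k` in monic polynomials with `f * g` of degree `m`. -/
noncomputable def productSolutions (m : ℕ) : Finset ((F[X] × F[X]) × (F[X] × F[X])) :=
  (monicPairs F m ×ˢ monicPairs F m).filter fun w => w.1.1 * w.1.2 = w.2.1 * w.2.2

/-- The parametrization of the solutions of `f * g = h * k`. -/
noncomputable def productParam (w : (F[X] × F[X]) × (F[X] × F[X])) :
    (F[X] × F[X]) × (F[X] × F[X]) :=
  ((w.1.1 * w.1.2, w.2.1 * w.2.2), (w.1.1 * w.2.1, w.1.2 * w.2.2))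

theorem productParam_mem {m : ℕ} {w : (F[X] × F[X]) × (F[X] × F[X])}
    (hw : w ∈ monicQuadruples F m) : productParam w ∈ productSolutions F m := by
  obtain ⟨h1, h2, h3, h4, h5⟩ := mem_monicQuadruples.1 hw
  simp only [productSolutions, productParam, Finset.mem_filter, Finset.mem_product,
    mem_monicPairs]
  refine ⟨⟨⟨h1.mul h2, h3.mul h4, ?_⟩, h1.mul h3, h2.mul h4, ?_⟩, by ring⟩
  · rw [h1.natDegree_mul h2, h3.natDegree_mul h4, h5]
  · rw [h1.natDegree_mul h3, h2.natDegree_mul h4, ← h5]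
    ring

theorem exists_productParam_eq {m : ℕ} {w : (F[X] × F[X]) × (F[X] × F[X])}
    (hw : w ∈ productSolutions F m) : ∃ v ∈ monicQuadruples F m, productParam v = w := by
  obtain ⟨⟨f, g⟩, h, k⟩ := w
  simp only [productSolutions, Finset.mem_filter, Finset.mem_product, mem_monicPairs] at hw
  obtain ⟨⟨⟨hf, hg, hd⟩, hh, hk, -⟩, he⟩ := hw
  obtain ⟨a, b, c, e, ha, hb, hc, he', rfl, rfl, rfl, rfl⟩ :=
    exists_monic_factorization_of_mul_eq_mul hf hh hk he
  refine ⟨((a, b), (c, e)), mem_monicQuadruples.2 ⟨ha, hb, hc, he', ?_⟩, rfl⟩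
  rw [← hd, ha.natDegree_mul hb, hc.natDegree_mul he']

theorem card_productSolutions_le (m : ℕ) :
    (productSolutions F m).card ≤ quadrupleCount m * Fintype.card F ^ m := by
  rw [← card_monicQuadruples]
  refine (Finset.card_le_card fun w hw => ?_).trans (Finset.card_image_le (f := productParam))
  obtain ⟨v, hv, h⟩ := exists_productParam_eq hw
  exact Finset.mem_image.2 ⟨v, hv, h⟩

/-- The generic quadruples: coprime to `Q`, with coprime middle terms. -/
def IsGenericQuadruple (Q : F[X]) (w : (F[X] × F[X]) × (F[X] × F[X])) : Prop :=
  IsCoprime w.1.1 Q ∧ IsCoprime w.1.2 Q ∧ IsCoprime w.2.1 Q ∧ IsCoprime w.2.2 Q ∧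
    IsCoprime w.2.1 w.1.2

theorem card_generic_le (Q : F[X]) (m : ℕ) :
    ((monicQuadruples F m).filter (IsGenericQuadruple Q)).card ≤
      ((productSolutions F m).filter fun w => IsCoprime (w.1.1 * w.1.2) Q).card := by
  refine Finset.card_le_card_of_injOn productParam ?_ ?_
  · intro w hw
    rw [Finset.coe_filter, Set.mem_ofPred_eq] at hw
    obtain ⟨h1, h2, h3, h4, h5, -⟩ := hw
    rw [Finset.mem_coe, Finset.mem_filter]
    exact ⟨productParam_mem h1, (h2.mul_left h3).mul_left (h4.mul_left h5)⟩
  · rintro ⟨⟨a, b⟩, c, e⟩ hw ⟨⟨a', b'⟩, c', e'⟩ hw' h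
    simp only [Finset.coe_filter, Set.mem_ofPred_eq, mem_monicQuadruples, IsGenericQuadruple]
      at hw hw'
    simp only [productParam, Prod.mk.injEq] at h
    obtain ⟨h1, h2, h3⟩ := eq_of_mul_eq_mul_of_isCoprime hw.1.1 hw'.1.1 hw.2.2.2.2.2.symm
      hw'.2.2.2.2.2.symm h.1.1 h.2.1
    subst h1 h2 h3
    rw [mul_left_cancel₀ hw.1.2.1.ne_zero h.2.2]

theorem sum_not_isCoprime_le {B : F[X]} (hB : B.Monic) (n : ℕ) :
    Fintype.card F * ∑ f ∈ monics F n, (if IsCoprime f B then 0 else 1) ≤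
      B.natDegree * Fintype.card F ^ n := by
  have := card_mul_card_not_isCoprime_le hB n
  rw [Finset.card_filter] at this
  simpa only [ite_not] using this

theorem card_not_generic_le {Q : F[X]} (hQ : Q.Monic) (m : ℕ) :
    Fintype.card F * ((monicQuadruples F m).filter fun w => ¬IsGenericQuadruple Q w).card ≤
      (4 * Q.natDegree + m) * quadrupleCount m * Fintype.card F ^ m := by
  set q := Fintype.card F
  have h1 : ((monicQuadruples F m).filter fun w => ¬IsGenericQuadruple Q w).card ≤
      ∑ w ∈ monicQuadruples F m, ((if IsCoprime w.1.1 Q then 0 else 1) +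
        (if IsCoprime w.1.2 Q then 0 else 1) + (if IsCoprime w.2.1 Q then 0 else 1) +
        (if IsCoprime w.2.2 Q then 0 else 1) + (if IsCoprime w.2.1 w.1.2 then 0 else 1)) := by
    rw [Finset.card_filter]
    refine Finset.sum_le_sum fun w _ => ?_
    simp only [IsGenericQuadruple]
    by_cases h1 : IsCoprime w.1.1 Q <;> by_cases h2 : IsCoprime w.1.2 Q <;>
      by_cases h3 : IsCoprime w.2.1 Q <;> by_cases h4 : IsCoprime w.2.2 Q <;>
      by_cases h5 : IsCoprime w.2.1 w.1.2 <;> simp [h1, h2, h3, h4, h5]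
  refine (Nat.mul_le_mul_left q h1).trans ?_
  rw [sum_monicQuadruples, quadrupleCount, Finset.mul_sum, Finset.mul_sum, Finset.sum_mul]
  refine Finset.sum_le_sum fun x hx => ?_
  have hblock : ∀ y ∈ antidiagonal x.1, ∀ z ∈ antidiagonal x.2,
      q * ∑ a ∈ monics F y.1, ∑ b ∈ monics F y.2, ∑ c ∈ monics F z.1, ∑ e ∈ monics F z.2,
        ((if IsCoprime a Q then 0 else 1) +
        (if IsCoprime b Q then 0 else 1) + (if IsCoprime c Q then 0 else 1) +
        (if IsCoprime e Q then 0 else 1) + (if IsCoprime c b then 0 else 1)) ≤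
      (4 * Q.natDegree + m) * q ^ m := by
    intro y hy z hz
    rw [mem_antidiagonal] at hx hy hz
    have hm : q ^ m = q ^ y.1 * q ^ y.2 * q ^ z.1 * q ^ z.2 := by
      rw [← hx, ← hy, ← hz, pow_add, pow_add, pow_add]
      ring
    have hbc : q * ∑ b ∈ monics F y.2, ∑ c ∈ monics F z.1, (if IsCoprime c b then 0 else 1) ≤
        m * (q ^ y.2 * q ^ z.1) := by
      rw [Finset.mul_sum]
      calc _ ≤ ∑ b ∈ monics F y.2, m * q ^ z.1 := by
            refine Finset.sum_le_sum fun b hb => ?_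
            rw [mem_monics] at hb
            refine (sum_not_isCoprime_le hb.1 z.1).trans (Nat.mul_le_mul_right _ ?_)
            omega
        _ = _ := by
            rw [Finset.sum_const, card_monics, smul_eq_mul]
            ring
    have ha := sum_not_isCoprime_le hQ y.1
    have hb := sum_not_isCoprime_le hQ y.2
    have hc := sum_not_isCoprime_le hQ z.1
    have he := sum_not_isCoprime_le hQ z.2
    simp only [Finset.sum_add_distrib, Finset.sum_const, card_monics, smul_eq_mul,
      ← Finset.mul_sum, hm]
    change q * _ ≤ _ at ha hb hc he
    generalize hA : ∑ f ∈ monics F y.1, (if IsCoprime f Q then 0 else 1) = A at *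
    generalize ∑ f ∈ monics F y.2, (if IsCoprime f Q then 0 else 1) = B at *
    generalize ∑ f ∈ monics F z.1, (if IsCoprime f Q then 0 else 1) = C' at *
    generalize ∑ f ∈ monics F z.2, (if IsCoprime f Q then 0 else 1) = E at *
    generalize ∑ b ∈ monics F y.2, ∑ c ∈ monics F z.1, (if IsCoprime c b then 0 else 1) = G at *
    have ha' := Nat.mul_le_mul_left (q ^ y.2 * q ^ z.1 * q ^ z.2) ha
    have hb' := Nat.mul_le_mul_left (q ^ y.1 * q ^ z.1 * q ^ z.2) hb
    have hc' := Nat.mul_le_mul_left (q ^ y.1 * q ^ y.2 * q ^ z.2) hc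
    have he' := Nat.mul_le_mul_left (q ^ y.1 * q ^ y.2 * q ^ z.1) he
    have hg' := Nat.mul_le_mul_left (q ^ y.1 * q ^ z.2) hbc
    change q * _ ≤ _
    nlinarith [ha', hb', hc', he', hg']
  calc _ = ∑ y ∈ antidiagonal x.1, ∑ z ∈ antidiagonal x.2,
        q * ∑ a ∈ monics F y.1, ∑ b ∈ monics F y.2, ∑ c ∈ monics F z.1, ∑ e ∈ monics F z.2,
        ((if IsCoprime a Q then 0 else 1) +
        (if IsCoprime b Q then 0 else 1) + (if IsCoprime c Q then 0 else 1) +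
        (if IsCoprime e Q then 0 else 1) + (if IsCoprime c b then 0 else 1)) := by
        rw [Finset.mul_sum]
        refine Finset.sum_congr rfl fun y _ => ?_
        rw [← Finset.mul_sum]
        congr 1
        rw [Finset.sum_comm' (s := antidiagonal x.2) (t := fun _ => monics F y.1)
          (t' := monics F y.1) (s' := fun _ => antidiagonal x.2) (by simp)]
        exact Finset.sum_congr rfl fun a _ => Finset.sum_comm
    _ ≤ ∑ y ∈ antidiagonal x.1, ∑ z ∈ antidiagonal x.2, (4 * Q.natDegree + m) * q ^ m :=
        Finset.sum_le_sum fun y hy => Finset.sum_le_sum fun z hz => hblock y hy z hz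
    _ = _ := by
        simp only [Finset.sum_const, smul_eq_mul, Finset.Nat.card_antidiagonal]
        ring

theorem card_coprime_solutions (Q : F[X]) (m : ℕ) :
    ((productSolutions F m).filter fun w => IsCoprime (w.1.1 * w.1.2) Q).card =
      ∑ f ∈ monics F m with IsCoprime f Q, dpoly F 2 f ^ 2 := by
  rw [Finset.card_eq_sum_card_fiberwise (f := fun w => w.1.1 * w.1.2)
    (t := (monics F m).filter fun f => IsCoprime f Q)]
  · refine Finset.sum_congr rfl fun f hf => ?_
    rw [Finset.mem_filter] at hf
    rw [sq, dpoly_two_eq_card hf.1, ← Finset.card_product]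
    congr 1
    ext w
    simp only [productSolutions, Finset.mem_filter, Finset.mem_product]
    constructor
    · rintro ⟨⟨⟨⟨h1, h2⟩, h3⟩, h4⟩, h5⟩
      exact ⟨⟨h1, h5⟩, h2, h3 ▸ h5⟩
    · rintro ⟨⟨h1, h2⟩, h3, h4⟩
      exact ⟨⟨⟨⟨h1, h3⟩, h2.trans h4.symm⟩, h2 ▸ hf.2⟩, h2⟩
  · intro w hw
    simp only [productSolutions, Finset.coe_filter, Finset.mem_filter, Finset.mem_product,
      Set.mem_ofPred_eq] at hw ⊢
    exact ⟨mul_mem_monics_of_mem_monicPairs hw.1.1.1, hw.2⟩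

/-- The second moment of the divisor function over the monic polynomials coprime to `Q`. -/
theorem abs_sum_dpoly_sq_sub_le {Q : F[X]} (hQ : Q.Monic) (m : ℕ) :
    (Fintype.card F : ℝ) * |∑ f ∈ monics F m with IsCoprime f Q, (dpoly F 2 f : ℝ) ^ 2 -
      quadrupleCount m * (Fintype.card F : ℝ) ^ m| ≤
      (4 * Q.natDegree + m) * quadrupleCount m * (Fintype.card F : ℝ) ^ m := by
  have h1 := card_coprime_solutions Q m
  have h2 := card_generic_le Q m
  have h3 := card_not_generic_le hQ m
  have h4 := Finset.card_filter_add_card_filter_not (s := monicQuadruples F m)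
    (IsGenericQuadruple Q)
  have h5 := (Finset.card_filter_le (productSolutions F m)
    fun w => IsCoprime (w.1.1 * w.1.2) Q).trans (card_productSolutions_le m)
  rw [card_monicQuadruples] at h4
  rw [h1] at h2 h5
  have h6 : (∑ f ∈ monics F m with IsCoprime f Q, (dpoly F 2 f : ℝ) ^ 2) =
    ((∑ f ∈ monics F m with IsCoprime f Q, dpoly F 2 f ^ 2 : ℕ) : ℝ) := by push_cast; rfl
  rw [h6, abs_of_nonpos (by rw [sub_nonpos]; exact_mod_cast h5)]
  have h3' := (Nat.cast_le (α := ℝ)).2 h3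
  have h4' : (_ : ℝ) = _ := congrArg Nat.cast h4
  have h2' := (Nat.cast_le (α := ℝ)).2 h2
  rw [Nat.cast_mul, Nat.cast_mul, Nat.cast_mul, Nat.cast_add, Nat.cast_mul, Nat.cast_pow,
    Nat.cast_ofNat] at h3'
  refine le_trans (mul_le_mul_of_nonneg_left ?_ (Nat.cast_nonneg _)) h3'
  rw [Nat.cast_add, Nat.cast_mul, Nat.cast_pow] at h4'
  linarith

end Counting

section CharacterSums

variable {F : Type} [Field F]

/-- A character modulo `Q` is even if it is trivial on the nonzero constants. -/
def IsEvenChar {Q : F[X]} (χ : MulChar (AdjoinRoot Q) ℂ) : Prop :=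
  ∀ c : Fˣ, χ (AdjoinRoot.of Q c) = 1

/-- A character modulo a squarefree `Q` is primitive if, for every prime factor `P` of `Q`, it is
nontrivial on the units congruent to `1` modulo `Q / P`. -/
def IsPrimitiveChar {Q : F[X]} (χ : MulChar (AdjoinRoot Q) ℂ) : Prop :=
  ∀ P Q' : F[X], P.Monic → Irreducible P → Q = P * Q' →
    ∃ u : (AdjoinRoot Q)ˣ, AdjoinRoot.mk Q Q' ∣ (u : AdjoinRoot Q) - 1 ∧ χ u ≠ 1

theorem IsPrimitiveChar.gaussSum_mulShift_eq_zero {Q : F[X]} [Fintype (AdjoinRoot Q)]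
    (hQ : Q ≠ 0) {χ : MulChar (AdjoinRoot Q) ℂ} (hχ : IsPrimitiveChar χ)
    (ψ : AddChar (AdjoinRoot Q) ℂ) {b : AdjoinRoot Q} (hb : ¬IsUnit b) :
    gaussSum χ (ψ.mulShift b) = 0 := by
  induction b using AdjoinRoot.induction_on with | ih g => ?_
  rw [AdjoinRoot.isUnit_mk_iff] at hb
  obtain ⟨P, hP, g', rfl⟩ := exists_primeFactor_dvd_of_not_isCoprime hQ hb
  obtain ⟨hPm, hPi, Q', hQ'⟩ := (mem_primeFactorsFinset hQ).1 hP
  obtain ⟨u, ⟨v, hv⟩, hu⟩ := hχ P Q' hPm hPi hQ'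
  have hPQ : AdjoinRoot.mk Q P * AdjoinRoot.mk Q Q' = 0 := by
    rw [← map_mul, ← hQ', AdjoinRoot.mk_self]
  have h1 : AdjoinRoot.mk Q (P * g') * u = AdjoinRoot.mk Q (P * g') := by
    rw [map_mul]
    linear_combination AdjoinRoot.mk Q P * AdjoinRoot.mk Q g' * hv +
      v * AdjoinRoot.mk Q g' * hPQ
  have h2 := gaussSum_mulShift χ (ψ.mulShift (AdjoinRoot.mk Q (P * g'))) u
  rw [AddChar.mulShift_mulShift, h1] at h2
  exact eq_zero_of_mul_eq_self_left hu h2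

section AdditiveCharacter

variable (Q : F[X]) [hQ : Fact Q.Monic]

/-- The coefficient of `X ^ (deg Q - 1)` in the reduced representative. -/
noncomputable def topCoeff : AdjoinRoot Q →+ F :=
  (lcoeff F (Q.natDegree - 1)).toAddMonoidHom.comp
    (AdjoinRoot.modByMonicHom hQ.out).toAddMonoidHom

variable {Q}

theorem topCoeff_mk {f : F[X]} (hf : f.degree < Q.natDegree) :
    topCoeff Q (AdjoinRoot.mk Q f) = f.coeff (Q.natDegree - 1) := by
  have h : f %ₘ Q = f := by
    rw [modByMonic_eq_self_iff hQ.out, degree_eq_natDegree hQ.out.ne_zero]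
    exact hf
  simp [topCoeff, AdjoinRoot.modByMonicHom_mk, h]

/-- The additive character of `F[X] / Q` induced by an additive character of `F`. -/
noncomputable def residueAddChar (Q : F[X]) [Fact Q.Monic] (ψ : AddChar F ℂ) :
    AddChar (AdjoinRoot Q) ℂ :=
  ψ.compAddMonoidHom (topCoeff Q)

theorem residueAddChar_mk (ψ : AddChar F ℂ) {f : F[X]} (hf : f.degree < Q.natDegree) :
    residueAddChar Q ψ (AdjoinRoot.mk Q f) = ψ (f.coeff (Q.natDegree - 1)) := by
  rw [residueAddChar, AddChar.compAddMonoidHom_apply, topCoeff_mk hf]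

theorem exists_residueAddChar_mul_ne_one {ψ : AddChar F ℂ} (hψ : ψ ≠ 1) {f : F[X]} (hf : f ≠ 0)
    (hd : f.natDegree < Q.natDegree) :
    ∃ e : F, residueAddChar Q ψ (AdjoinRoot.mk Q
      (monomial (Q.natDegree - 1 - f.natDegree) e * f)) ≠ 1 := by
  obtain ⟨a, ha⟩ := AddChar.ne_one_iff.1 hψ
  have hl := leadingCoeff_ne_zero.2 hf
  refine ⟨a / f.leadingCoeff, ?_⟩
  have hdeg : (monomial (Q.natDegree - 1 - f.natDegree) (a / f.leadingCoeff) * f).degree <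
      Q.natDegree := by
    refine (degree_mul_le _ _).trans_lt
      ((add_le_add (degree_monomial_le _ _) degree_le_natDegree).trans_lt ?_)
    norm_cast
    omega
  rw [residueAddChar_mk ψ hdeg]
  obtain ⟨k, hk⟩ : ∃ k, Q.natDegree - 1 = f.natDegree + k :=
    ⟨Q.natDegree - 1 - f.natDegree, by omega⟩
  rw [hk, Nat.add_sub_cancel_left, coeff_monomial_mul]
  rwa [coeff_natDegree, div_mul_cancel₀ _ hl]

theorem residueAddChar_isPrimitive [Fintype F] {ψ : AddChar F ℂ} (hψ : ψ ≠ 1) :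
    (residueAddChar Q ψ).IsPrimitive := by
  intro x hx
  obtain ⟨f, hf, rfl⟩ := exists_mem_lowDegree_mk_eq hQ.out x
  have hf0 : f ≠ 0 := by
    rintro rfl
    exact hx (map_zero _)
  rw [mem_lowDegree, degree_eq_natDegree hf0] at hf
  obtain ⟨e, he⟩ := exists_residueAddChar_mul_ne_one hψ hf0 (Q := Q) (by exact_mod_cast hf)
  rw [AddChar.ne_one_iff]
  refine ⟨AdjoinRoot.mk Q (monomial (Q.natDegree - 1 - f.natDegree) e), ?_⟩
  rwa [AddChar.mulShift_apply, ← map_mul, mul_comm]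

end AdditiveCharacter

variable [Fintype F]

theorem sum_lowDegree_add {M : Type*} [AddCommMonoid M] {n : ℕ} {h : F[X]} (hh : h ∈ lowDegree F n)
    (g : F[X] → M) : ∑ f ∈ lowDegree F n, g (h + f) = ∑ f ∈ lowDegree F n, g f := by
  rw [mem_lowDegree] at hh
  refine Finset.sum_bij' (fun f _ => h + f) (fun f _ => f - h) ?_ ?_ ?_ ?_ ?_
  · intro f hf
    rw [mem_lowDegree] at hf ⊢
    exact (degree_add_le _ _).trans_lt (max_lt hh hf)
  · intro f hf
    rw [mem_lowDegree] at hf ⊢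
    exact (degree_sub_le _ _).trans_lt (max_lt hf hh)
  · intro f _
    ring
  · intro f _
    ring
  · intro f _
    rfl

theorem sum_lowDegree_succ {M : Type*} [AddCommMonoid M] (n : ℕ) (g : F[X] → M) :
    ∑ f ∈ lowDegree F (n + 1), g f =
      ∑ f ∈ lowDegree F n, g f + ∑ c : Fˣ, ∑ f ∈ monics F n, g (C (c : F) * f) := by
  rw [← Finset.sum_filter_add_sum_filter_not _ (· ∈ lowDegree F n)]
  congr 1
  · refine Finset.sum_congr ?_ fun _ _ => rfl
    ext f
    simp only [Finset.mem_filter, mem_lowDegree, and_iff_right_iff_imp]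
    exact fun h => h.trans (by exact_mod_cast Nat.lt_succ_self n)
  · rw [← Finset.sum_product']
    refine (Finset.sum_bij (fun p _ => C (p.1 : F) * p.2) ?_ ?_ ?_ ?_).symm
    · intro p hp
      rw [Finset.mem_product, mem_monics] at hp
      have : (C (p.1 : F) * p.2).degree = n := by
        rw [degree_C_mul p.1.ne_zero, degree_eq_natDegree hp.2.1.ne_zero, hp.2.2]
      simp only [Finset.mem_filter, mem_lowDegree, this]
      norm_cast
      simp
    · rintro ⟨c, f⟩ hp ⟨c', f'⟩ hp' h
      rw [Finset.mem_product, mem_monics] at hp hp'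
      simp only at h hp hp'
      have hc := congrArg leadingCoeff h
      rw [leadingCoeff_mul, leadingCoeff_mul, hp.2.1.leadingCoeff, hp'.2.1.leadingCoeff,
        leadingCoeff_C, leadingCoeff_C, mul_one, mul_one] at hc
      have hc' := Units.ext hc
      subst hc'
      rw [mul_left_cancel₀ (C_ne_zero.2 c.ne_zero) h]
    · intro f hf
      simp only [Finset.mem_filter, mem_lowDegree, not_lt] at hf
      have hdeg : f.degree = n := by
        refine le_antisymm ?_ hf.2
        rw [degree_le_iff_coeff_zero]
        intro m hm
        exact (degree_lt_iff_coeff_zero f _).1 hf.1 m (by exact_mod_cast hm)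
      have hf0 : f ≠ 0 := by
        rintro rfl
        simp at hdeg
      have hl := leadingCoeff_ne_zero.2 hf0
      refine ⟨(Units.mk0 _ hl, f * C f.leadingCoeff⁻¹), ?_, ?_⟩
      · rw [Finset.mem_product, mem_monics]
        refine ⟨Finset.mem_univ _, monic_mul_leadingCoeff_inv hf0, ?_⟩
        rw [natDegree_mul_C (inv_ne_zero hl)]
        exact natDegree_eq_of_degree_eq_some hdeg
      · simp only [Units.val_mk0]
        rw [mul_left_comm, ← C_mul, mul_inv_cancel₀ hl, C_1, mul_one]
    · intro _ _
      rfl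

variable {Q : F[X]} [hQ : Fact Q.Monic]

theorem sum_residueAddChar_mul {ψ : AddChar F ℂ} (hψ : ψ ≠ 1) {i : ℕ} (hi : i < Q.natDegree)
    (y : AdjoinRoot Q) :
    ∑ b ∈ lowDegree F (Q.natDegree - i), residueAddChar Q ψ (AdjoinRoot.mk Q b * y) =
      if y ∈ (lowDegree F i).image (AdjoinRoot.mk Q) then
        (Fintype.card F : ℂ) ^ (Q.natDegree - i) else 0 := by
  split_ifs with hy
  · obtain ⟨f, hf, rfl⟩ := Finset.mem_image.1 hy
    rw [mem_lowDegree] at hf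
    rw [Finset.sum_congr rfl (g := fun _ => 1)]
    · simp [card_lowDegree]
    · intro b hb
      rw [mem_lowDegree] at hb
      by_cases hbf : b * f = 0
      · rw [← map_mul, hbf, map_zero, AddChar.map_zero_eq_one]
      · obtain ⟨hb0, hf0⟩ := mul_ne_zero_iff.1 hbf
        have h1 : f.natDegree < i := (natDegree_lt_iff_degree_lt hf0).2 hf
        have h2 : b.natDegree < Q.natDegree - i := (natDegree_lt_iff_degree_lt hb0).2 hb
        have h3 : (b * f).natDegree < Q.natDegree - 1 := by
          rw [natDegree_mul hb0 hf0]
          omega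
        rw [← map_mul, residueAddChar_mk, coeff_eq_zero_of_natDegree_lt h3,
          AddChar.map_zero_eq_one]
        rw [← natDegree_lt_iff_degree_lt hbf]
        omega
  · obtain ⟨f, hf, rfl⟩ := exists_mem_lowDegree_mk_eq hQ.out y
    have hfi : f ∉ lowDegree F i := fun h => hy (Finset.mem_image_of_mem _ h)
    have hf0 : f ≠ 0 := by
      rintro rfl
      exact hfi (mem_lowDegree.2 (by simp))
    rw [mem_lowDegree, ← natDegree_lt_iff_degree_lt hf0] at hf hfi
    obtain ⟨e, he⟩ := exists_residueAddChar_mul_ne_one hψ hf0 hf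
    set h := monomial (Q.natDegree - 1 - f.natDegree) e
    have hh : h ∈ lowDegree F (Q.natDegree - i) := by
      rw [mem_lowDegree]
      refine (degree_monomial_le _ _).trans_lt ?_
      norm_cast
      omega
    refine eq_zero_of_mul_eq_self_left he ?_
    conv_rhs => rw [← sum_lowDegree_add hh]
    rw [Finset.mul_sum]
    refine Finset.sum_congr rfl fun b _ => ?_
    rw [map_add, add_mul, AddChar.map_add_eq_mul, map_mul (AdjoinRoot.mk Q)]

/-- The sum of a character over the monic polynomials of degree `i`. -/
noncomputable def charSum (χ : MulChar (AdjoinRoot Q) ℂ) (i : ℕ) : ℂ :=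
  ∑ f ∈ monics F i, χ (AdjoinRoot.mk Q f)

theorem charSum_eq_zero {χ : MulChar (AdjoinRoot Q) ℂ} (hχ : χ ≠ 1) {i : ℕ}
    (hi : Q.natDegree ≤ i) : charSum χ i = 0 := by
  have h1 : ∀ h ∈ lowDegree F Q.natDegree,
      charSum χ i = ∑ f ∈ monics F i, χ (AdjoinRoot.mk Q f + AdjoinRoot.mk Q h) := by
    intro h hh
    have hh' : h ∈ lowDegree F i := by
      rw [mem_lowDegree] at hh ⊢
      exact hh.trans_le (by exact_mod_cast hi)
    rw [charSum, monics_eq_image_lowDegree, Finset.sum_image (by simp), Finset.sum_image (by simp),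
      ← sum_lowDegree_add hh']
    refine Finset.sum_congr rfl fun f _ => ?_
    rw [← map_add]
    congr 2
    ring
  have h2 := Finset.sum_congr rfl h1
  rw [Finset.sum_const, card_lowDegree, Finset.sum_comm, Finset.sum_eq_zero] at h2
  · simpa using h2
  · intro f _
    rw [sum_lowDegree_mk fun y => χ (AdjoinRoot.mk Q f + y),
      ← MulChar.sum_eq_zero_of_ne_one hχ]
    exact Fintype.sum_equiv (Equiv.addLeft (AdjoinRoot.mk Q f)) _ _ fun _ => rfl

/-- Poisson summation for a primitive character over the monic polynomials of degree `i`. -/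
theorem IsPrimitiveChar.pow_mul_charSum {χ : MulChar (AdjoinRoot Q) ℂ} (hχ : IsPrimitiveChar χ)
    {ψ : AddChar F ℂ} (hψ : ψ ≠ 1) {i : ℕ} (hi : i < Q.natDegree) :
    (Fintype.card F : ℂ) ^ (Q.natDegree - i) * charSum χ i =
      gaussSum χ (residueAddChar Q ψ) * ∑ b ∈ lowDegree F (Q.natDegree - i),
        ψ (-b.coeff (Q.natDegree - i - 1)) * conj (χ (AdjoinRoot.mk Q b)) := by
  have hτ : ∀ b, gaussSum χ (residueAddChar Q ψ) * conj (χ b) =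
      ∑ x, χ x * residueAddChar Q ψ (b * x) := by
    intro b
    by_cases hb : IsUnit b
    · obtain ⟨u, rfl⟩ := hb
      rw [χ.conj_apply, mul_comm, ← gaussSum_mulShift_eq]
      simp only [gaussSum, AddChar.mulShift_apply]
    · have h := hχ.gaussSum_mulShift_eq_zero hQ.out.ne_zero (residueAddChar Q ψ) hb
      simp only [gaussSum, AddChar.mulShift_apply] at h
      rw [χ.map_nonunit hb, map_zero, mul_zero, h]
  have hb : ∀ b ∈ lowDegree F (Q.natDegree - i), gaussSum χ (residueAddChar Q ψ) *
      (ψ (-b.coeff (Q.natDegree - i - 1)) * conj (χ (AdjoinRoot.mk Q b))) =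
      ∑ x, χ x * residueAddChar Q ψ (AdjoinRoot.mk Q b * (x - AdjoinRoot.mk Q (X ^ i))) := by
    intro b hb
    rw [mem_lowDegree] at hb
    rw [mul_left_comm, hτ, Finset.mul_sum]
    refine Finset.sum_congr rfl fun x _ => ?_
    rw [mul_sub, sub_eq_neg_add, AddChar.map_add_eq_mul, ← map_mul (AdjoinRoot.mk Q),
      ← map_neg (AdjoinRoot.mk Q), residueAddChar_mk, coeff_neg,
      show Q.natDegree - 1 = Q.natDegree - i - 1 + i by omega, coeff_mul_X_pow]
    · ring
    · rw [degree_neg]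
      refine (degree_mul_le _ _).trans_lt ?_
      rw [degree_X_pow]
      calc b.degree + (i : WithBot ℕ) < ((Q.natDegree - i : ℕ) : WithBot ℕ) + i :=
            WithBot.add_lt_add_right (by simp) hb
        _ = _ := by
            norm_cast
            omega
  rw [Finset.mul_sum, Finset.sum_congr rfl hb, Finset.sum_comm]
  simp_rw [← Finset.mul_sum, sum_residueAddChar_mul hψ hi, mul_ite, mul_zero]
  rw [← Finset.sum_filter, ← Finset.sum_mul, mul_comm]
  congr 1
  rw [charSum, ← Finset.sum_image (f := fun x => χ x) (injOn_mk_monics hQ.out hi.le)]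
  refine Finset.sum_congr ?_ fun _ _ => rfl
  ext x
  simp only [monics_eq_image_lowDegree, Finset.mem_image, Finset.mem_filter, Finset.mem_univ,
    true_and, exists_exists_and_eq_and, map_add]
  refine exists_congr fun f => and_congr_right fun _ => ?_
  rw [eq_sub_iff_add_eq']

end CharacterSums

section FunctionalEquation

theorem sum_units_eq_sum_filter {R M : Type*} [CommRing R] [Fintype R] [AddCommMonoid M]
    (g : R → M) : ∑ u : Rˣ, g u = ∑ x with IsUnit x, g x := by
  rw [← Finset.sum_image (f := g) fun _ _ _ _ h => Units.val_injective h]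
  refine Finset.sum_congr ?_ fun _ _ => rfl
  ext b
  simp only [Finset.mem_filter, Finset.mem_univ, true_and, Finset.mem_image]
  rfl

theorem MulChar.sum_mul_eq_sum_units {R : Type*} [CommRing R] [Fintype R] (χ : MulChar R ℂ)
    (g : R → ℂ) : ∑ x, χ x * g x = ∑ u : Rˣ, χ u * g u := by
  rw [sum_units_eq_sum_filter fun x => χ x * g x, Finset.sum_filter]
  refine Finset.sum_congr rfl fun x _ => ?_
  split_ifs with h
  · rfl
  · rw [χ.map_nonunit h, zero_mul]

/-- The restriction of a character modulo `Q` to the constants. -/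
noncomputable def constChar {F : Type} [Field F] {Q : F[X]} (χ : MulChar (AdjoinRoot Q) ℂ) :
    MulChar F ℂ :=
  MulChar.ofUnitHom (χ.toUnitHom.comp (Units.map (AdjoinRoot.of Q : F →* AdjoinRoot Q)))

theorem constChar_apply {F : Type} [Field F] {Q : F[X]} (χ : MulChar (AdjoinRoot Q) ℂ) (c : Fˣ) :
    constChar χ c = χ (AdjoinRoot.of Q c) := by
  rw [constChar, MulChar.ofUnitHom_coe]
  rfl

theorem constChar_eq_one_iff {F : Type} [Field F] {Q : F[X]} {χ : MulChar (AdjoinRoot Q) ℂ} :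
    constChar χ = 1 ↔ IsEvenChar χ := by
  rw [MulChar.ext_iff]
  simp only [constChar_apply, MulChar.one_apply_coe]
  rfl

variable {F : Type} [Field F] [Fintype F]

theorem norm_gaussSum_sq {χ : MulChar F ℂ} (hχ : χ ≠ 1) {ψ : AddChar F ℂ} (hψ : ψ ≠ 1) :
    ‖gaussSum χ ψ‖ ^ 2 = Fintype.card F := by
  refine norm_gaussSum_sq_of_separable (AddChar.IsPrimitive.of_ne_one hψ) fun b hb => ?_
  rw [isUnit_iff_ne_zero, not_not] at hb
  rw [hb, AddChar.mulShift_zero, gaussSum_one_right hχ]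

variable (F) in
theorem exists_addChar_ne_one : ∃ ψ : AddChar F ℂ, ψ ≠ 1 := by
  obtain ⟨ψ, hψ⟩ := (AddChar.exists_apply_ne_zero (a := (1 : F))).2 one_ne_zero
  exact ⟨ψ, AddChar.ne_one_iff.2 ⟨1, hψ⟩⟩

theorem sum_lowDegree_apply {Q : F[X]} (hd : 0 < Q.natDegree) (χ : MulChar (AdjoinRoot Q) ℂ)
    (n : ℕ) :
    ∑ b ∈ lowDegree F n, χ (AdjoinRoot.mk Q b) =
      (∑ c : Fˣ, χ (AdjoinRoot.of Q c)) * ∑ k ∈ Finset.range n, charSum χ k := by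
  induction n with
  | zero =>
    have h0 : lowDegree F 0 = {0} := by
      ext f
      simp [mem_lowDegree, Nat.WithBot.lt_zero_iff]
    have hnu : ¬IsUnit (0 : AdjoinRoot Q) := by
      rw [← map_zero (AdjoinRoot.mk Q), AdjoinRoot.isUnit_mk_iff, isCoprime_zero_left]
      exact fun h => hd.ne' (natDegree_eq_zero_of_isUnit h)
    simp [h0, χ.map_nonunit hnu]
  | succ n ih =>
    rw [sum_lowDegree_succ, ih, Finset.sum_range_succ, mul_add, charSum]
    simp_rw [map_mul, AdjoinRoot.mk_C, Finset.sum_mul_sum]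

theorem sum_apply_const {Q : F[X]} (χ : MulChar (AdjoinRoot Q) ℂ) :
    ∑ c : Fˣ, χ (AdjoinRoot.of Q c) =
      if IsEvenChar χ then (Fintype.card Fˣ : ℂ) else 0 := by
  split_ifs with he
  · rw [Finset.sum_congr rfl fun c _ => he c]
    simp
  · rw [← MulChar.sum_eq_zero_of_ne_one fun h => he (constChar_eq_one_iff.1 h)]
    have := (constChar χ).sum_mul_eq_sum_units fun _ => 1
    simp only [mul_one] at this
    rw [this]
    exact Finset.sum_congr rfl fun c _ => (constChar_apply χ c).symm

variable {Q : F[X]} [hQ : Fact Q.Monic]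

theorem card_adjoinRoot : Fintype.card (AdjoinRoot Q) = Fintype.card F ^ Q.natDegree := by
  have h := sum_lowDegree_mk (Q := Q) fun _ => 1
  rw [Finset.sum_const, card_lowDegree, Finset.sum_const, Finset.card_univ] at h
  simpa using h.symm

theorem IsPrimitiveChar.pow_mul_charSum_eq {χ : MulChar (AdjoinRoot Q) ℂ} (hχ : IsPrimitiveChar χ)
    {ψ : AddChar F ℂ} (hψ : ψ ≠ 1) {i : ℕ} (hi : i < Q.natDegree) :
    (Fintype.card F : ℂ) ^ (Q.natDegree - i) * charSum χ i =
      gaussSum χ (residueAddChar Q ψ) * conj (gaussSum (constChar χ) ψ *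
        charSum χ (Q.natDegree - 1 - i) + (∑ c : Fˣ, χ (AdjoinRoot.of Q c)) *
          ∑ k ∈ Finset.range (Q.natDegree - 1 - i), charSum χ k) := by
  rw [hχ.pow_mul_charSum hψ hi]
  obtain ⟨n, hn⟩ : ∃ n, Q.natDegree - i = n + 1 := ⟨Q.natDegree - i - 1, by omega⟩
  have hn' : Q.natDegree - 1 - i = n := by omega
  rw [hn, hn', Nat.add_sub_cancel, ← sum_lowDegree_apply (by omega), sum_lowDegree_succ, add_comm]
  congr 1
  rw [map_add, map_mul, map_sum]
  congr 1
  · rw [gaussSum, MulChar.sum_mul_eq_sum_units, map_sum, charSum, map_sum, Finset.sum_mul_sum]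
    refine Finset.sum_congr rfl fun c _ => Finset.sum_congr rfl fun f hf => ?_
    rw [mem_monics] at hf
    have hc : (C (c : F) * f).coeff n = c := by
      rw [coeff_C_mul, ← hf.2, hf.1.coeff_natDegree, mul_one]
    rw [hc, constChar_apply, map_mul (AdjoinRoot.mk Q), map_mul χ, AdjoinRoot.mk_C,
      AddChar.map_neg_eq_conj, map_mul, map_mul]
    ring
  · refine Finset.sum_congr rfl fun f hf => ?_
    rw [mem_lowDegree] at hf
    rw [coeff_eq_zero_of_degree_lt hf, neg_zero, AddChar.map_zero_eq_one, one_mul]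

theorem IsPrimitiveChar.norm_gaussSum_residueAddChar_sq {χ : MulChar (AdjoinRoot Q) ℂ}
    (hχ : IsPrimitiveChar χ) {ψ : AddChar F ℂ} (hψ : ψ ≠ 1) :
    ‖gaussSum χ (residueAddChar Q ψ)‖ ^ 2 = (Fintype.card F : ℝ) ^ Q.natDegree := by
  rw [norm_gaussSum_sq_of_separable (residueAddChar_isPrimitive hψ) fun b hb =>
    hχ.gaussSum_mulShift_eq_zero hQ.out.ne_zero _ hb, card_adjoinRoot, Nat.cast_pow]

/-- The functional equation for primitive odd characters. -/
theorem IsPrimitiveChar.norm_charSum_sq_of_not_even {χ : MulChar (AdjoinRoot Q) ℂ}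
    (hχ : IsPrimitiveChar χ) (ho : ¬IsEvenChar χ) {i : ℕ} (hi : i < Q.natDegree) :
    ((Fintype.card F : ℝ) ^ (Q.natDegree - i) * ‖charSum χ i‖) ^ 2 =
      (Fintype.card F : ℝ) ^ (Q.natDegree + 1) * ‖charSum χ (Q.natDegree - 1 - i)‖ ^ 2 := by
  obtain ⟨ψ, hψ⟩ := exists_addChar_ne_one F
  have hc : constChar χ ≠ 1 := fun h => ho (constChar_eq_one_iff.1 h)
  have h0 : ∑ c : Fˣ, χ (AdjoinRoot.of Q c) = 0 := by
    rw [sum_apply_const, if_neg ho]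
  have h := congrArg norm (hχ.pow_mul_charSum_eq hψ hi)
  rw [h0, zero_mul, add_zero, norm_mul, norm_mul, RCLike.norm_conj, norm_mul, norm_pow,
    Complex.norm_natCast] at h
  rw [h, mul_pow, mul_pow, hχ.norm_gaussSum_residueAddChar_sq hψ, norm_gaussSum_sq hc hψ]
  ring

/-- The functional equation for primitive even characters. -/
theorem IsPrimitiveChar.norm_charSum_sq_le_of_even {χ : MulChar (AdjoinRoot Q) ℂ}
    (hχ : IsPrimitiveChar χ) (he : IsEvenChar χ) {i : ℕ} (hi : i < Q.natDegree) :
    ((Fintype.card F : ℝ) ^ (Q.natDegree - i) * ‖charSum χ i‖) ^ 2 ≤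
      (Fintype.card F : ℝ) ^ Q.natDegree * (‖charSum χ (Q.natDegree - 1 - i)‖ +
        Fintype.card F * ∑ k ∈ Finset.range (Q.natDegree - 1 - i), ‖charSum χ k‖) ^ 2 := by
  obtain ⟨ψ, hψ⟩ := exists_addChar_ne_one F
  have h := congrArg norm (hχ.pow_mul_charSum_eq hψ hi)
  rw [constChar_eq_one_iff.2 he, gaussSum_one_left hψ, norm_mul, norm_mul, RCLike.norm_conj,
    norm_pow, Complex.norm_natCast] at h
  rw [h, mul_pow, hχ.norm_gaussSum_residueAddChar_sq hψ]
  refine mul_le_mul_of_nonneg_left (pow_le_pow_left₀ (norm_nonneg _) ?_ 2) (by positivity)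
  refine (norm_add_le _ _).trans (add_le_add ?_ ?_)
  · simp
  · rw [norm_mul]
    refine mul_le_mul ?_ (norm_sum_le _ _) (norm_nonneg _) (Nat.cast_nonneg _)
    rw [sum_apply_const, if_pos he, Complex.norm_natCast]
    exact_mod_cast Fintype.card_le_of_injective _ Units.val_injective

end FunctionalEquation

section DirectMoments

theorem MulChar.sum_apply_mul_norm_sum_sq {R ι : Type*} [CommRing R] [Fintype R] (s : Finset ι)
    (v : ι → R) {c : R} (hc : IsUnit c) :
    ∑ χ : MulChar R ℂ, χ c * ((‖∑ p ∈ s, χ (v p)‖ ^ 2 : ℝ) : ℂ) = (Fintype.card Rˣ : ℂ) *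
      ((s ×ˢ s).filter fun w => IsUnit (v w.1) ∧ c * v w.1 = v w.2).card := by
  have h (χ : MulChar R ℂ) : χ c * ((‖∑ p ∈ s, χ (v p)‖ ^ 2 : ℝ) : ℂ) =
      ∑ w ∈ s ×ˢ s, χ c * χ (v w.1) * conj (χ (v w.2)) := by
    rw [← Complex.normSq_eq_norm_sq, ← Complex.mul_conj, map_sum, Finset.sum_mul_sum,
      Finset.sum_product, Finset.mul_sum]
    simp_rw [Finset.mul_sum, mul_assoc]
  simp_rw [h]
  rw [Finset.sum_comm]
  simp_rw [MulChar.sum_apply_mul_conj c _ _ hc]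
  rw [← Finset.sum_filter, Finset.sum_const, nsmul_eq_mul, mul_comm]

theorem MulChar.sum_norm_sum_sq {R ι : Type*} [CommRing R] [Fintype R] (s : Finset ι)
    (v : ι → R) :
    ∑ χ : MulChar R ℂ, ‖∑ p ∈ s, χ (v p)‖ ^ 2 = (Fintype.card Rˣ : ℝ) *
      ((s ×ˢ s).filter fun w => IsUnit (v w.1) ∧ v w.1 = v w.2).card := by
  have h := MulChar.sum_apply_mul_norm_sum_sq s v isUnit_one
  simp only [map_one, one_mul] at h
  exact_mod_cast h

theorem quadrupleCount_le (m : ℕ) : quadrupleCount m ≤ (m + 1) ^ 3 := by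
  rw [quadrupleCount]
  refine (Finset.sum_le_card_nsmul _ _ ((m + 1) ^ 2) fun p hp => ?_).trans ?_
  · rw [mem_antidiagonal] at hp
    rw [sq]
    exact Nat.mul_le_mul (by omega) (by omega)
  · simp [pow_succ, mul_comm]

variable {F : Type} [Field F] [Fintype F]

theorem charSum_mul_charSum {Q : F[X]} (χ : MulChar (AdjoinRoot Q) ℂ) (i j : ℕ) :
    charSum χ i * charSum χ j =
      ∑ p ∈ monics F i ×ˢ monics F j, χ (AdjoinRoot.mk Q (p.1 * p.2)) := by
  rw [charSum, charSum, Finset.sum_mul_sum, Finset.sum_product]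
  simp_rw [map_mul]

variable {Q : F[X]} [hQ : Fact Q.Monic]

theorem card_units_le :
    (Fintype.card (AdjoinRoot Q)ˣ : ℝ) ≤ (Fintype.card F : ℝ) ^ Q.natDegree := by
  rw [← Nat.cast_pow, ← card_adjoinRoot]
  exact_mod_cast Fintype.card_le_of_injective _ Units.val_injective

/-- The congruences `c * f * g ≡ h * k` between monic polynomials are equalities in low degree. -/
theorem filter_mul_congr_subset {i : ℕ} (hi : 2 * i < Q.natDegree) (c : Fˣ) :
    (((monics F i ×ˢ monics F i) ×ˢ (monics F i ×ˢ monics F i)).filter fun w =>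
      IsUnit (AdjoinRoot.mk Q (w.1.1 * w.1.2)) ∧
        AdjoinRoot.of Q c * AdjoinRoot.mk Q (w.1.1 * w.1.2) = AdjoinRoot.mk Q (w.2.1 * w.2.2)) ⊆
      if c = 1 then productSolutions F (2 * i) else ∅ := by
  intro w hw
  simp only [Finset.mem_filter, Finset.mem_product] at hw
  obtain ⟨⟨⟨h1, h2⟩, h3, h4⟩, -, h⟩ := hw
  have h12 := mem_monics.1 (mul_mem_monics h1 h2)
  have h34 := mem_monics.1 (mul_mem_monics h3 h4)
  rw [← AdjoinRoot.mk_C, ← map_mul] at h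
  have e : C (c : F) * (w.1.1 * w.1.2) = w.2.1 * w.2.2 := by
    refine eq_of_mk_eq_mk h ((degree_sub_le _ _).trans_lt ?_)
    rw [degree_C_mul c.ne_zero, degree_eq_natDegree h12.1.ne_zero,
      degree_eq_natDegree h34.1.ne_zero, h12.2, h34.2, max_self,
      degree_eq_natDegree hQ.out.ne_zero]
    norm_cast
    omega
  have hc := congrArg leadingCoeff e
  rw [leadingCoeff_mul, leadingCoeff_C, h12.1.leadingCoeff, h34.1.leadingCoeff, mul_one] at hc
  have hc1 : c = 1 := Units.ext hc
  rw [if_pos hc1, productSolutions]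
  simp only [Finset.mem_filter, Finset.mem_product, mem_monicPairs]
  rw [mem_monics] at h1 h2 h3 h4
  rw [hc1, Units.val_one, C_1, one_mul] at e
  exact ⟨⟨⟨h1.1, h2.1, by omega⟩, h3.1, h4.1, by omega⟩, e⟩

theorem sum_norm_charSum_pow_four_le {i : ℕ} (hi : 2 * i < Q.natDegree) :
    ∑ χ : MulChar (AdjoinRoot Q) ℂ, ‖charSum χ i‖ ^ 4 ≤
      (2 * i + 1 : ℝ) ^ 3 * (Fintype.card F : ℝ) ^ (Q.natDegree + 2 * i) := by
  have h := MulChar.sum_norm_sum_sq (R := AdjoinRoot Q) (monics F i ×ˢ monics F i)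
    fun p => AdjoinRoot.mk Q (p.1 * p.2)
  simp_rw [← charSum_mul_charSum, norm_mul, ← sq, ← pow_mul] at h
  rw [h, pow_add, mul_left_comm]
  refine mul_le_mul card_units_le ?_ (Nat.cast_nonneg _) (by positivity)
  have h1 := filter_mul_congr_subset hi (1 : Fˣ)
  simp only [Units.val_one, map_one, one_mul, if_true] at h1
  have h2 := (Finset.card_le_card h1).trans ((card_productSolutions_le (2 * i)).trans
    (Nat.mul_le_mul_right _ (quadrupleCount_le _)))
  exact_mod_cast h2

theorem card_le_two_mul_card_units : Fintype.card F ≤ 2 * Fintype.card Fˣ := by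
  have h1 := Fintype.card_units (α := F)
  have h2 := Fintype.one_lt_card (α := F)
  omega

theorem sum_even_norm_charSum_pow_four_le {i : ℕ} (hi : 2 * i < Q.natDegree) :
    Fintype.card F * ∑ χ : MulChar (AdjoinRoot Q) ℂ with IsEvenChar χ, ‖charSum χ i‖ ^ 4 ≤
      2 * (2 * i + 1 : ℝ) ^ 3 * (Fintype.card F : ℝ) ^ (Q.natDegree + 2 * i) := by
  have key : (Fintype.card Fˣ : ℝ) *
      ∑ χ : MulChar (AdjoinRoot Q) ℂ with IsEvenChar χ, ‖charSum χ i‖ ^ 4 =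
      (Fintype.card (AdjoinRoot Q)ˣ : ℝ) * ∑ c : Fˣ,
        ((((monics F i ×ˢ monics F i) ×ˢ (monics F i ×ˢ monics F i)).filter fun w =>
          IsUnit (AdjoinRoot.mk Q (w.1.1 * w.1.2)) ∧
            AdjoinRoot.of Q c * AdjoinRoot.mk Q (w.1.1 * w.1.2) =
              AdjoinRoot.mk Q (w.2.1 * w.2.2)).card : ℝ) := by
    have h (c : Fˣ) := MulChar.sum_apply_mul_norm_sum_sq (R := AdjoinRoot Q)
      (monics F i ×ˢ monics F i) (fun p => AdjoinRoot.mk Q (p.1 * p.2))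
      (c.isUnit.map (AdjoinRoot.of Q))
    simp_rw [← charSum_mul_charSum, norm_mul, ← sq, ← pow_mul] at h
    have h' := Finset.sum_congr rfl fun c (_ : c ∈ Finset.univ) => h c
    rw [Finset.sum_comm, ← Finset.mul_sum] at h'
    simp_rw [← Finset.sum_mul, sum_apply_const, ite_mul, zero_mul] at h'
    rw [← Finset.sum_filter, ← Finset.mul_sum] at h'
    exact_mod_cast h'
  have h1 (c : Fˣ) : ((((monics F i ×ˢ monics F i) ×ˢ (monics F i ×ˢ monics F i)).filter fun w =>
      IsUnit (AdjoinRoot.mk Q (w.1.1 * w.1.2)) ∧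
        AdjoinRoot.of Q c * AdjoinRoot.mk Q (w.1.1 * w.1.2) =
          AdjoinRoot.mk Q (w.2.1 * w.2.2)).card : ℝ) ≤
      if c = 1 then (2 * i + 1 : ℝ) ^ 3 * (Fintype.card F : ℝ) ^ (2 * i) else 0 := by
    have h2 := Finset.card_le_card (filter_mul_congr_subset (Q := Q) hi c)
    split_ifs at h2 ⊢ with hc
    · have h3 := h2.trans ((card_productSolutions_le (2 * i)).trans
        (Nat.mul_le_mul_right _ (quadrupleCount_le _)))
      exact_mod_cast h3
    · exact_mod_cast h2
  have h2 := Finset.sum_le_sum fun c (_ : c ∈ Finset.univ) => h1 c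
  rw [Finset.sum_ite_eq', if_pos (Finset.mem_univ _)] at h2
  calc _ ≤ (2 * Fintype.card Fˣ : ℝ) *
        ∑ χ : MulChar (AdjoinRoot Q) ℂ with IsEvenChar χ, ‖charSum χ i‖ ^ 4 := by
        refine mul_le_mul_of_nonneg_right ?_ (by positivity)
        exact_mod_cast card_le_two_mul_card_units
    _ = 2 * _ := by rw [mul_assoc, key]
    _ ≤ 2 * ((Fintype.card F : ℝ) ^ Q.natDegree *
        ((2 * i + 1 : ℝ) ^ 3 * (Fintype.card F : ℝ) ^ (2 * i))) := by
        refine mul_le_mul_of_nonneg_left ?_ two_pos.le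
        exact mul_le_mul card_units_le h2 (by positivity) (by positivity)
    _ = _ := by
        rw [pow_add]
        ring

end DirectMoments

section Imprimitive

theorem add_pow_four_le {x y : ℝ} (hx : 0 ≤ x) (hy : 0 ≤ y) :
    (x + y) ^ 4 ≤ 8 * (x ^ 4 + y ^ 4) := by
  have := add_pow_le hx hy 4
  norm_num at this
  exact this

variable {F : Type} [Field F] {P Q' : F[X]}

/-- A character modulo `P * Q'` that is trivial on the units congruent to `1` modulo `Q'` comes
from a character modulo `Q'`. -/
theorem exists_char_of_forall_apply_eq_one (hP : IsCoprime P Q')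
    {χ : MulChar (AdjoinRoot (P * Q')) ℂ}
    (hχ : ∀ u : (AdjoinRoot (P * Q'))ˣ,
      AdjoinRoot.mk (P * Q') Q' ∣ (u : AdjoinRoot (P * Q')) - 1 → χ u = 1) :
    ∃ χ' : MulChar (AdjoinRoot Q') ℂ, ∀ f, IsCoprime f (P * Q') →
      χ (AdjoinRoot.mk (P * Q') f) = χ' (AdjoinRoot.mk Q' f) := by
  have heval (f : F[X]) : eval₂ (AdjoinRoot.of Q') (AdjoinRoot.root Q') f = AdjoinRoot.mk Q' f :=
    AdjoinRoot.aeval_eq f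
  let r : AdjoinRoot (P * Q') →+* AdjoinRoot Q' :=
    AdjoinRoot.lift (AdjoinRoot.of Q') (AdjoinRoot.root Q') (by
      rw [heval, AdjoinRoot.mk_eq_zero]
      exact dvd_mul_left _ _)
  have hr (f : F[X]) : r (AdjoinRoot.mk (P * Q') f) = AdjoinRoot.mk Q' f := by
    rw [AdjoinRoot.lift_mk, heval]
  let ρ : (AdjoinRoot (P * Q'))ˣ →* (AdjoinRoot Q')ˣ := Units.map r
  have hρ : Function.Surjective ρ := by
    intro u
    obtain ⟨g, hg⟩ := AdjoinRoot.mk_surjective (u : AdjoinRoot Q')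
    have hgc : IsCoprime g Q' := AdjoinRoot.isUnit_mk_iff.1 (hg ▸ u.isUnit)
    obtain ⟨a, b, hab⟩ := hP
    have hf1 : IsCoprime (g * (a * P) + b * Q') P :=
      ⟨1, (1 - g) * a, by linear_combination hab⟩
    have e : g * (a * P) + b * Q' = g + (b * (1 - g)) * Q' := by linear_combination g * hab
    have hf2 : IsCoprime (g * (a * P) + b * Q') Q' := by
      rw [e]
      exact (IsCoprime.add_mul_right_left_iff).2 hgc
    have hu := AdjoinRoot.isUnit_mk_iff.2 (hf1.mul_right hf2)
    refine ⟨hu.unit, Units.ext ?_⟩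
    change r (AdjoinRoot.mk (P * Q') _) = u
    rw [hr, ← hg, AdjoinRoot.mk_eq_mk, e]
    exact ⟨b * (1 - g), by ring⟩
  have hker : ρ.ker ≤ χ.toUnitHom.ker := by
    intro u hu
    obtain ⟨f, hf⟩ := AdjoinRoot.mk_surjective (u : AdjoinRoot (P * Q'))
    have h1 : r u = 1 := congrArg Units.val (MonoidHom.mem_ker.1 hu)
    rw [← hf, hr, ← map_one (AdjoinRoot.mk Q'), AdjoinRoot.mk_eq_mk] at h1
    refine Units.ext ?_
    rw [MulChar.coe_toUnitHom]
    refine hχ u ?_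
    rw [← hf, ← map_one (AdjoinRoot.mk (P * Q')), ← map_sub]
    exact map_dvd _ h1
  refine ⟨MulChar.ofUnitHom (ρ.liftOfSurjective hρ ⟨χ.toUnitHom, hker⟩), fun f hf => ?_⟩
  have hu := AdjoinRoot.isUnit_mk_iff.2 hf
  have h2 : AdjoinRoot.mk Q' f = (ρ hu.unit : AdjoinRoot Q') := (hr f).symm
  rw [h2, MulChar.ofUnitHom_coe, MonoidHom.liftOfRightInverse_comp_apply, MulChar.coe_toUnitHom]
  rfl

theorem charSum_eq_sub [Fintype F] (hPm : P.Monic) (hPi : Irreducible P)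
    {χ : MulChar (AdjoinRoot (P * Q')) ℂ} {χ' : MulChar (AdjoinRoot Q') ℂ}
    (h : ∀ f, IsCoprime f (P * Q') → χ (AdjoinRoot.mk (P * Q') f) = χ' (AdjoinRoot.mk Q' f))
    (i : ℕ) : charSum χ i = charSum χ' i -
      if P.natDegree ≤ i then χ' (AdjoinRoot.mk Q' P) * charSum χ' (i - P.natDegree) else 0 := by
  have h1 : (if P.natDegree ≤ i then χ' (AdjoinRoot.mk Q' P) * charSum χ' (i - P.natDegree)
      else 0) = ∑ f ∈ monics F i with P ∣ f, χ' (AdjoinRoot.mk Q' f) := by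
    split_ifs with hi
    · rw [filter_dvd_monics hPm hi,
        Finset.sum_image fun _ _ _ _ e => mul_left_cancel₀ hPm.ne_zero e, charSum, Finset.mul_sum]
      simp_rw [map_mul]
    · rw [filter_dvd_monics_eq_empty (not_le.1 hi), Finset.sum_empty]
  rw [h1, charSum, charSum, ← Finset.sum_filter_add_sum_filter_not (monics F i) (P ∣ ·)
    fun f => χ' (AdjoinRoot.mk Q' f), add_sub_cancel_left, Finset.sum_filter]
  refine Finset.sum_congr rfl fun f _ => ?_
  split_ifs with hf
  · refine χ.map_nonunit fun hu => hPi.not_isUnit ?_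
    exact (AdjoinRoot.isUnit_mk_iff.1 hu).of_mul_right_left.isUnit_of_dvd' hf dvd_rfl
  · have hPf : IsCoprime f P := (hPi.coprime_iff_not_dvd.2 hf).symm
    by_cases hc : IsCoprime f Q'
    · exact h f (hPf.mul_right hc)
    · rw [χ'.map_nonunit fun hu => hc (AdjoinRoot.isUnit_mk_iff.1 hu), χ.map_nonunit fun hu =>
        hc (AdjoinRoot.isUnit_mk_iff.1 hu).of_mul_right_right]

variable [Fintype F]

theorem sum_norm_charSum_pow_four_le_of_reduction (hPm : P.Monic) (hPi : Irreducible P)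
    (hPQ : IsCoprime P Q') [Fact Q'.Monic] [Fact (P * Q').Monic] {B : ℝ} {i : ℕ}
    (hB : ∀ j ≤ i, ∑ χ' : MulChar (AdjoinRoot Q') ℂ with χ' ≠ 1, ‖charSum χ' j‖ ^ 4 ≤ B) :
    ∑ χ : MulChar (AdjoinRoot (P * Q')) ℂ with χ ≠ 1 ∧ ∀ u : (AdjoinRoot (P * Q'))ˣ,
      AdjoinRoot.mk (P * Q') Q' ∣ (u : AdjoinRoot (P * Q')) - 1 → χ u = 1,
        ‖charSum χ i‖ ^ 4 ≤ 16 * B := by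
  set S := Finset.univ.filter fun χ : MulChar (AdjoinRoot (P * Q')) ℂ =>
    χ ≠ 1 ∧ ∀ u : (AdjoinRoot (P * Q'))ˣ,
      AdjoinRoot.mk (P * Q') Q' ∣ (u : AdjoinRoot (P * Q')) - 1 → χ u = 1
  have hex : ∀ χ : S, ∃ χ' : MulChar (AdjoinRoot Q') ℂ, ∀ f, IsCoprime f (P * Q') →
      χ.1 (AdjoinRoot.mk (P * Q') f) = χ' (AdjoinRoot.mk Q' f) := fun χ =>
    exists_char_of_forall_apply_eq_one hPQ (Finset.mem_filter.1 χ.2).2.2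
  choose Λ hΛ using hex
  have hinj : Function.Injective Λ := by
    intro χ₁ χ₂ h
    refine Subtype.ext (MulChar.ext fun u => ?_)
    obtain ⟨f, hf⟩ := AdjoinRoot.mk_surjective (u : AdjoinRoot (P * Q'))
    have hc := AdjoinRoot.isUnit_mk_iff.1 (hf ▸ u.isUnit)
    rw [← hf, hΛ χ₁ f hc, hΛ χ₂ f hc, h]
  have hne (χ : S) : Λ χ ≠ 1 := by
    intro h
    refine (Finset.mem_filter.1 χ.2).2.1 (MulChar.ext fun u => ?_)
    obtain ⟨f, hf⟩ := AdjoinRoot.mk_surjective (u : AdjoinRoot (P * Q'))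
    have hc := AdjoinRoot.isUnit_mk_iff.1 (hf ▸ u.isUnit)
    rw [MulChar.one_apply_coe, ← hf, hΛ χ f hc, h, MulChar.one_apply]
    exact AdjoinRoot.isUnit_mk_iff.2 hc.of_mul_right_right
  have hB0 : 0 ≤ B := le_trans (by positivity) (hB 0 (Nat.zero_le _))
  have hbound (χ : S) : ‖charSum χ.1 i‖ ^ 4 ≤ 8 * (‖charSum (Λ χ) i‖ ^ 4 +
      if P.natDegree ≤ i then ‖charSum (Λ χ) (i - P.natDegree)‖ ^ 4 else 0) := by
    rw [charSum_eq_sub hPm hPi (hΛ χ)]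
    refine (pow_le_pow_left₀ (norm_nonneg _) (norm_sub_le _ _) 4).trans
      ((add_pow_four_le (norm_nonneg _) (norm_nonneg _)).trans ?_)
    refine mul_le_mul_of_nonneg_left (add_le_add le_rfl ?_) (by norm_num)
    split_ifs
    · rw [norm_mul]
      refine pow_le_pow_left₀ (by positivity) ?_ 4
      exact mul_le_of_le_one_left (norm_nonneg _) (MulChar.norm_apply_le_one _ _)
    · simp
  calc ∑ χ ∈ S, ‖charSum χ i‖ ^ 4 = ∑ χ : S, ‖charSum χ.1 i‖ ^ 4 :=
        (Finset.sum_coe_sort S fun χ => ‖charSum χ i‖ ^ 4).symm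
    _ ≤ ∑ χ : S, 8 * (‖charSum (Λ χ) i‖ ^ 4 +
        if P.natDegree ≤ i then ‖charSum (Λ χ) (i - P.natDegree)‖ ^ 4 else 0) :=
        Finset.sum_le_sum fun χ _ => hbound χ
    _ = ∑ χ' ∈ Finset.univ.image Λ, 8 * (‖charSum χ' i‖ ^ 4 +
        if P.natDegree ≤ i then ‖charSum χ' (i - P.natDegree)‖ ^ 4 else 0) :=
        by rw [Finset.sum_image fun _ _ _ _ h => hinj h]
    _ ≤ ∑ χ' : MulChar (AdjoinRoot Q') ℂ with χ' ≠ 1, 8 * (‖charSum χ' i‖ ^ 4 +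
        if P.natDegree ≤ i then ‖charSum χ' (i - P.natDegree)‖ ^ 4 else 0) := by
        refine Finset.sum_le_sum_of_subset_of_nonneg ?_ fun χ' _ _ => by split_ifs <;> positivity
        intro χ' hχ'
        obtain ⟨χ, -, rfl⟩ := Finset.mem_image.1 hχ'
        exact Finset.mem_filter.2 ⟨Finset.mem_univ _, hne χ⟩
    _ ≤ 8 * (B + B) := by
        rw [← Finset.mul_sum, Finset.sum_add_distrib]
        refine mul_le_mul_of_nonneg_left (add_le_add (hB i le_rfl) ?_) (by norm_num)
        split_ifs
        · exact hB _ (Nat.sub_le _ _)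
        · simpa using hB0
    _ = 16 * B := by ring

end Imprimitive

section FourthMoment

/-- The constant in the fourth moment bound for primitive characters. -/
def primitiveConst (d : ℕ) : ℝ := 16 * (d ^ 4 + 1) * (2 * d + 1) ^ 3

theorem primitiveConst_nonneg (d : ℕ) : 0 ≤ primitiveConst d := by
  unfold primitiveConst
  positivity

theorem sum_range_pow_four_le {m : ℕ} {a : ℕ → ℝ} (ha : ∀ k, 0 ≤ a k) :
    (∑ k ∈ Finset.range m, a k) ^ 4 ≤ m ^ 3 * ∑ k ∈ Finset.range m, a k ^ 4 := by
  simpa using pow_sum_le_card_mul_sum_pow (s := Finset.range m) (fun k _ => ha k) 3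

theorem sum_biUnion_le_sum {ι κ : Type*} [DecidableEq κ] (s : Finset ι) (t : ι → Finset κ)
    {f : κ → ℝ}
    (hf : ∀ x, 0 ≤ f x) : ∑ x ∈ s.biUnion t, f x ≤ ∑ i ∈ s, ∑ x ∈ t i, f x := by
  induction s using Finset.induction_on with
  | empty => simp
  | insert a s ha ih =>
    rw [Finset.biUnion_insert, Finset.sum_insert ha]
    have h := Finset.sum_union_inter (s₁ := t a) (s₂ := s.biUnion t) (f := f)
    have h0 := Finset.sum_nonneg (s := t a ∩ s.biUnion t) fun x _ => hf x
    linarith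

variable {F : Type} [Field F] [Fintype F] {Q : F[X]} [hQ : Fact Q.Monic]

theorem one_le_card_real (F : Type) [Field F] [Fintype F] : (1 : ℝ) ≤ Fintype.card F := by
  exact_mod_cast Fintype.card_pos (α := F)

/-- Fourth moment over primitive even characters. -/
theorem sum_primitive_even_norm_charSum_pow_four_le (i : ℕ) :
    Fintype.card F * ∑ χ : MulChar (AdjoinRoot Q) ℂ with χ ≠ 1 ∧ IsPrimitiveChar χ ∧ IsEvenChar χ,
      ‖charSum χ i‖ ^ 4 ≤
      primitiveConst Q.natDegree * (Fintype.card F : ℝ) ^ (Q.natDegree + 2 * i) := by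
  set q := (Fintype.card F : ℝ)
  have hq : 1 ≤ q := one_le_card_real F
  set d := Q.natDegree with hd
  have hle (k : ℕ) : ∑ χ : MulChar (AdjoinRoot Q) ℂ with
      χ ≠ 1 ∧ IsPrimitiveChar χ ∧ IsEvenChar χ, ‖charSum χ k‖ ^ 4 ≤
      ∑ χ : MulChar (AdjoinRoot Q) ℂ with IsEvenChar χ, ‖charSum χ k‖ ^ 4 :=
    Finset.sum_le_sum_of_subset_of_nonneg
      (fun χ hχ => by simp only [Finset.mem_filter] at hχ ⊢; exact ⟨hχ.1, hχ.2.2.2⟩)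
      fun _ _ _ => by positivity
  have hsmall {k N : ℕ} (hk : 2 * k < d) (hN : 2 * k ≤ N) :
      q * ∑ χ : MulChar (AdjoinRoot Q) ℂ with χ ≠ 1 ∧ IsPrimitiveChar χ ∧ IsEvenChar χ,
        ‖charSum χ k‖ ^ 4 ≤ 2 * (2 * d + 1 : ℝ) ^ 3 * q ^ (d + N) := by
    refine (mul_le_mul_of_nonneg_left (hle k) (by positivity)).trans
      ((sum_even_norm_charSum_pow_four_le hk).trans ?_)
    have : (k : ℝ) ≤ d := by exact_mod_cast (by omega : k ≤ d)
    gcongr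
  by_cases h1 : 2 * i < d
  · refine (hsmall h1 le_rfl).trans (mul_le_mul_of_nonneg_right ?_ (by positivity))
    unfold primitiveConst
    refine mul_le_mul_of_nonneg_right ?_ (by positivity)
    nlinarith [pow_nonneg (Nat.cast_nonneg (α := ℝ) d) 4]
  by_cases h2 : d ≤ i
  · rw [Finset.sum_eq_zero, mul_zero]
    · exact mul_nonneg (primitiveConst_nonneg _) (by positivity)
    · intro χ hχ
      rw [charSum_eq_zero (Finset.mem_filter.1 hχ).2.1 h2, norm_zero, zero_pow (by norm_num)]
  obtain ⟨m, hm⟩ : ∃ m, d - 1 - i = m := ⟨_, rfl⟩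
  have hpt : ∀ χ ∈ Finset.univ.filter fun χ : MulChar (AdjoinRoot Q) ℂ =>
      χ ≠ 1 ∧ IsPrimitiveChar χ ∧ IsEvenChar χ, q ^ (4 * (d - i)) * ‖charSum χ i‖ ^ 4 ≤
      8 * q ^ (2 * d) * (‖charSum χ m‖ ^ 4 +
        q ^ 4 * (m ^ 3 * ∑ k ∈ Finset.range m, ‖charSum χ k‖ ^ 4)) := by
    intro χ hχ
    obtain ⟨-, -, hp, he⟩ := Finset.mem_filter.1 hχ
    have h := hp.norm_charSum_sq_le_of_even he (not_le.1 h2)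
    rw [← hd, hm] at h
    have h' := pow_le_pow_left₀ (sq_nonneg _) h 2
    calc q ^ (4 * (d - i)) * ‖charSum χ i‖ ^ 4 = ((q ^ (d - i) * ‖charSum χ i‖) ^ 2) ^ 2 := by ring
      _ ≤ q ^ (2 * d) * (‖charSum χ m‖ + q * ∑ k ∈ Finset.range m, ‖charSum χ k‖) ^ 4 := by
        refine h'.trans (le_of_eq ?_)
        ring
      _ ≤ q ^ (2 * d) * (8 * (‖charSum χ m‖ ^ 4 +
            (q * ∑ k ∈ Finset.range m, ‖charSum χ k‖) ^ 4)) := by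
        gcongr
        exact add_pow_four_le (norm_nonneg _)
          (mul_nonneg (by positivity) (Finset.sum_nonneg fun _ _ => norm_nonneg _))
      _ ≤ q ^ (2 * d) * (8 * (‖charSum χ m‖ ^ 4 +
            q ^ 4 * (m ^ 3 * ∑ k ∈ Finset.range m, ‖charSum χ k‖ ^ 4))) := by
        rw [mul_pow]
        gcongr
        exact sum_range_pow_four_le fun _ => norm_nonneg _
      _ = _ := by ring
  have hsum := Finset.sum_le_sum hpt
  rw [← Finset.mul_sum, ← Finset.mul_sum, Finset.sum_add_distrib, ← Finset.mul_sum,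
    ← Finset.mul_sum, Finset.sum_comm] at hsum
  set E : ℕ → ℝ := fun k => ∑ χ : MulChar (AdjoinRoot Q) ℂ with
    χ ≠ 1 ∧ IsPrimitiveChar χ ∧ IsEvenChar χ, ‖charSum χ k‖ ^ 4
  change q * E i ≤ _
  change q ^ (4 * (d - i)) * E i ≤
    8 * q ^ (2 * d) * (E m + q ^ 4 * (m ^ 3 * ∑ k ∈ Finset.range m, E k)) at hsum
  set K : ℝ := 2 * (2 * d + 1 : ℝ) ^ 3
  have hK : 0 ≤ K := by positivity
  have hm1 : q * E m ≤ K * q ^ (d + (2 * m + 2)) := hsmall (by omega) (by omega)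
  have hm2 : q ^ 4 * (q * ∑ k ∈ Finset.range m, E k) ≤ m * (K * q ^ (d + (2 * m + 2))) := by
    rw [Finset.mul_sum, Finset.mul_sum]
    refine (Finset.sum_le_card_nsmul (Finset.range m) _ (K * q ^ (d + (2 * m + 2))) ?_).trans ?_
    · intro k hk
      rw [Finset.mem_range] at hk
      have h : q * E k ≤ K * q ^ (d + (2 * m - 2)) := hsmall (by omega) (by omega)
      refine (mul_le_mul_of_nonneg_left h (by positivity)).trans (le_of_eq ?_)
      rw [mul_left_comm, ← pow_add]
      congr 2
      omega
    · rw [Finset.card_range, nsmul_eq_mul]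
  have hmd : (m : ℝ) ≤ d := by exact_mod_cast (by omega : m ≤ d)
  refine le_of_mul_le_mul_left ?_ (by positivity : 0 < q ^ (4 * (d - i)))
  calc q ^ (4 * (d - i)) * (q * E i) = q * (q ^ (4 * (d - i)) * E i) := by ring
    _ ≤ q * (8 * q ^ (2 * d) * (E m + q ^ 4 * (m ^ 3 * ∑ k ∈ Finset.range m, E k))) := by gcongr
    _ = 8 * q ^ (2 * d) * (q * E m + m ^ 3 * (q ^ 4 * (q * ∑ k ∈ Finset.range m, E k))) := by ring
    _ ≤ 8 * q ^ (2 * d) * (K * q ^ (d + (2 * m + 2)) +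
          m ^ 3 * (m * (K * q ^ (d + (2 * m + 2))))) := by gcongr
    _ = 8 * (m ^ 4 + 1) * K * (q ^ (2 * d) * q ^ (d + (2 * m + 2))) := by ring
    _ ≤ 8 * (d ^ 4 + 1) * K * (q ^ (2 * d) * q ^ (d + (2 * m + 2))) := by gcongr
    _ = primitiveConst d * (q ^ (4 * (d - i)) * q ^ (d + 2 * i)) := by
      rw [← pow_add, ← pow_add, (by omega : 2 * d + (d + (2 * m + 2)) = 4 * (d - i) + (d + 2 * i))]
      unfold primitiveConst
      ring
    _ = _ := by ring

/-- Fourth moment over primitive odd characters. -/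
theorem sum_primitive_odd_norm_charSum_pow_four_le (i : ℕ) :
    ∑ χ : MulChar (AdjoinRoot Q) ℂ with χ ≠ 1 ∧ IsPrimitiveChar χ ∧ ¬IsEvenChar χ,
      ‖charSum χ i‖ ^ 4 ≤
      primitiveConst Q.natDegree * (Fintype.card F : ℝ) ^ (Q.natDegree + 2 * i) := by
  set q := (Fintype.card F : ℝ)
  have hq : 1 ≤ q := one_le_card_real F
  set d := Q.natDegree with hd
  have hsmall {k : ℕ} (hk : 2 * k < d) :
      ∑ χ : MulChar (AdjoinRoot Q) ℂ with χ ≠ 1 ∧ IsPrimitiveChar χ ∧ ¬IsEvenChar χ,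
        ‖charSum χ k‖ ^ 4 ≤ primitiveConst d * q ^ (d + 2 * k) := by
    refine (Finset.sum_le_sum_of_subset_of_nonneg (Finset.filter_subset _ _)
      fun _ _ _ => by positivity).trans ((sum_norm_charSum_pow_four_le hk).trans ?_)
    refine mul_le_mul_of_nonneg_right ?_ (by positivity)
    have : (k : ℝ) ≤ d := by exact_mod_cast (by omega : k ≤ d)
    unfold primitiveConst
    calc (2 * k + 1 : ℝ) ^ 3 ≤ 1 * (2 * d + 1 : ℝ) ^ 3 := by
          rw [one_mul]
          gcongr
      _ ≤ _ := by
          gcongr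
          nlinarith [pow_nonneg (Nat.cast_nonneg (α := ℝ) d) 4]
  by_cases h1 : 2 * i < d
  · exact hsmall h1
  by_cases h2 : d ≤ i
  · rw [Finset.sum_eq_zero]
    · exact mul_nonneg (primitiveConst_nonneg _) (by positivity)
    · intro χ hχ
      rw [charSum_eq_zero (Finset.mem_filter.1 hχ).2.1 h2, norm_zero, zero_pow (by norm_num)]
  obtain ⟨m, hm⟩ : ∃ m, d - 1 - i = m := ⟨_, rfl⟩
  have hpt : ∀ χ ∈ Finset.univ.filter fun χ : MulChar (AdjoinRoot Q) ℂ =>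
      χ ≠ 1 ∧ IsPrimitiveChar χ ∧ ¬IsEvenChar χ, q ^ (4 * (d - i)) * ‖charSum χ i‖ ^ 4 =
      q ^ (2 * d + 2) * ‖charSum χ m‖ ^ 4 := by
    intro χ hχ
    obtain ⟨-, -, hp, he⟩ := Finset.mem_filter.1 hχ
    have h := hp.norm_charSum_sq_of_not_even he (not_le.1 h2)
    rw [← hd, hm] at h
    calc q ^ (4 * (d - i)) * ‖charSum χ i‖ ^ 4 = ((q ^ (d - i) * ‖charSum χ i‖) ^ 2) ^ 2 := by ring
      _ = (q ^ (d + 1) * ‖charSum χ m‖ ^ 2) ^ 2 := by rw [h]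
      _ = _ := by ring
  refine le_of_mul_le_mul_left ?_ (by positivity : 0 < q ^ (4 * (d - i)))
  rw [Finset.mul_sum, Finset.sum_congr rfl hpt, ← Finset.mul_sum]
  refine (mul_le_mul_of_nonneg_left (hsmall (by omega)) (by positivity)).trans (le_of_eq ?_)
  rw [mul_left_comm, mul_left_comm _ (primitiveConst d), ← pow_add, ← pow_add]
  congr 2
  omega

/-- Fourth moment over imprimitive characters, from the bounds for the proper divisors of `Q`. -/
theorem sum_imprimitive_norm_charSum_pow_four_le (hsq : Squarefree Q) {C : ℝ} (hC : 0 ≤ C)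
    (h : ∀ Q' : F[X], ∀ _ : Fact Q'.Monic, Squarefree Q' → Q'.natDegree < Q.natDegree → ∀ j : ℕ,
      ∑ χ' : MulChar (AdjoinRoot Q') ℂ with χ' ≠ 1, ‖charSum χ' j‖ ^ 4 ≤
        C * (Fintype.card F : ℝ) ^ (Q'.natDegree + 2 * j)) (i : ℕ) :
    Fintype.card F * ∑ χ : MulChar (AdjoinRoot Q) ℂ with χ ≠ 1 ∧ ¬IsPrimitiveChar χ,
      ‖charSum χ i‖ ^ 4 ≤
      Q.natDegree * (16 * C * (Fintype.card F : ℝ) ^ (Q.natDegree + 2 * i)) := by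
  have hq : (1 : ℝ) ≤ Fintype.card F := one_le_card_real F
  let T (P : F[X]) : Finset (MulChar (AdjoinRoot Q) ℂ) := Finset.univ.filter fun χ =>
    χ ≠ 1 ∧ ∀ Q', Q = P * Q' → ∀ u : (AdjoinRoot Q)ˣ,
      AdjoinRoot.mk Q Q' ∣ (u : AdjoinRoot Q) - 1 → χ u = 1
  have hsub : (Finset.univ.filter fun χ : MulChar (AdjoinRoot Q) ℂ =>
      χ ≠ 1 ∧ ¬IsPrimitiveChar χ) ⊆ (primeFactorsFinset Q).biUnion T := by
    intro χ hχ
    obtain ⟨-, h1, hp⟩ := Finset.mem_filter.1 hχ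
    simp only [IsPrimitiveChar, not_forall, not_exists, not_and, not_not] at hp
    obtain ⟨P, Q', hPm, hPi, hPQ, hu⟩ := hp
    refine Finset.mem_biUnion.2 ⟨P, (mem_primeFactorsFinset hQ.out.ne_zero).2
      ⟨hPm, hPi, Q', hPQ⟩, Finset.mem_filter.2 ⟨Finset.mem_univ _, h1, fun Q'' hQ'' => ?_⟩⟩
    rwa [← mul_left_cancel₀ hPm.ne_zero (hPQ.symm.trans hQ'')]
  have hT : ∀ P ∈ primeFactorsFinset Q, Fintype.card F * ∑ χ ∈ T P, ‖charSum χ i‖ ^ 4 ≤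
      16 * C * (Fintype.card F : ℝ) ^ (Q.natDegree + 2 * i) := by
    intro P hP
    obtain ⟨hPm, hPi, Q', hPQ⟩ := (mem_primeFactorsFinset hQ.out.ne_zero).1 hP
    subst hPQ
    have hQ' : Q'.Monic := hPm.of_mul_monic_left hQ.out
    have : Fact Q'.Monic := ⟨hQ'⟩
    have hdeg : (P * Q').natDegree = P.natDegree + Q'.natDegree := hPm.natDegree_mul hQ'
    have hPd : 0 < P.natDegree := hPi.natDegree_pos
    have hred := sum_norm_charSum_pow_four_le_of_reduction (i := i)
      (B := C * (Fintype.card F : ℝ) ^ (Q'.natDegree + 2 * i)) hPm hPi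
      (IsRelPrime.isCoprime (squarefree_mul_iff.1 hsq).1) fun j hj =>
        (h Q' this hsq.of_mul_right (by omega) j).trans (by gcongr)
    refine (mul_le_mul_of_nonneg_left ((Finset.sum_le_sum_of_subset_of_nonneg ?_
      fun _ _ _ => by positivity).trans hred) (by positivity)).trans ?_
    · intro χ hχ
      obtain ⟨-, h1, hu⟩ := Finset.mem_filter.1 hχ
      exact Finset.mem_filter.2 ⟨Finset.mem_univ _, h1, hu Q' rfl⟩
    · calc (Fintype.card F : ℝ) * (16 * (C * (Fintype.card F : ℝ) ^ (Q'.natDegree + 2 * i)))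
          = 16 * C * (Fintype.card F : ℝ) ^ (Q'.natDegree + 2 * i + 1) := by ring
        _ ≤ _ := mul_le_mul_of_nonneg_left (pow_le_pow_right₀ hq (by omega)) (by positivity)
  calc (Fintype.card F : ℝ) * ∑ χ : MulChar (AdjoinRoot Q) ℂ with χ ≠ 1 ∧ ¬IsPrimitiveChar χ,
        ‖charSum χ i‖ ^ 4
      ≤ Fintype.card F * ∑ P ∈ primeFactorsFinset Q, ∑ χ ∈ T P, ‖charSum χ i‖ ^ 4 := by
        gcongr
        refine (Finset.sum_le_sum_of_subset_of_nonneg hsub fun _ _ _ => by positivity).trans ?_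
        exact sum_biUnion_le_sum (f := fun χ => ‖charSum χ i‖ ^ 4) _ _ fun _ => by positivity
    _ = ∑ P ∈ primeFactorsFinset Q, Fintype.card F * ∑ χ ∈ T P, ‖charSum χ i‖ ^ 4 :=
        Finset.mul_sum _ _ _
    _ ≤ (primeFactorsFinset Q).card •
          (16 * C * (Fintype.card F : ℝ) ^ (Q.natDegree + 2 * i)) :=
        Finset.sum_le_card_nsmul _ _ _ hT
    _ ≤ _ := by
        rw [nsmul_eq_mul]
        gcongr
        exact card_primeFactorsFinset_le hQ.out

/-- Uniform fourth moment bounds, with a saving over the characters that are not both primitive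
and odd. -/
theorem exists_fourth_moment_bound (d : ℕ) : ∃ C : ℝ, 0 ≤ C ∧
    ∀ (F : Type) [Field F] [Fintype F] (Q : F[X]) (_ : Fact Q.Monic), Squarefree Q →
      Q.natDegree ≤ d → ∀ i : ℕ,
        ∑ χ : MulChar (AdjoinRoot Q) ℂ with χ ≠ 1, ‖charSum χ i‖ ^ 4 ≤
          C * (Fintype.card F : ℝ) ^ (Q.natDegree + 2 * i) ∧
        Fintype.card F * ∑ χ : MulChar (AdjoinRoot Q) ℂ with
          χ ≠ 1 ∧ ¬(IsPrimitiveChar χ ∧ ¬IsEvenChar χ), ‖charSum χ i‖ ^ 4 ≤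
          C * (Fintype.card F : ℝ) ^ (Q.natDegree + 2 * i) := by
  induction d with
  | zero =>
    refine ⟨0, le_rfl, fun F _ _ Q _ _ hd i => ?_⟩
    have h (χ : MulChar (AdjoinRoot Q) ℂ) (hχ : χ ≠ 1) : ‖charSum χ i‖ ^ 4 = 0 := by
      rw [charSum_eq_zero hχ (hd.trans (Nat.zero_le i)), norm_zero, zero_pow (by norm_num)]
    rw [Finset.sum_eq_zero fun χ hχ => h χ (Finset.mem_filter.1 hχ).2,
      Finset.sum_eq_zero fun χ hχ => h χ (Finset.mem_filter.1 hχ).2.1]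
    simp
  | succ d ih =>
    obtain ⟨C, hC, ih⟩ := ih
    have hK := primitiveConst_nonneg (d + 1)
    refine ⟨C + 2 * primitiveConst (d + 1) + (d + 1 : ℕ) * (16 * C), by positivity,
      fun F _ _ Q _ hsq hd i => ?_⟩
    have hq : (1 : ℝ) ≤ Fintype.card F := one_le_card_real F
    have hX : 0 ≤ (Fintype.card F : ℝ) ^ (Q.natDegree + 2 * i) := by positivity
    rcases Nat.lt_or_eq_of_le hd with hlt | heq
    · have hle : C * (Fintype.card F : ℝ) ^ (Q.natDegree + 2 * i) ≤
          (C + 2 * primitiveConst (d + 1) + (d + 1 : ℕ) * (16 * C)) *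
            (Fintype.card F : ℝ) ^ (Q.natDegree + 2 * i) := by
        refine mul_le_mul_of_nonneg_right ?_ hX
        have : 0 ≤ ((d + 1 : ℕ) : ℝ) * (16 * C) := by positivity
        linarith
      exact ⟨(ih F Q _ hsq (by omega) i).1.trans hle, (ih F Q _ hsq (by omega) i).2.trans hle⟩
    have h1 := sum_imprimitive_norm_charSum_pow_four_le hsq hC
      (fun Q' hQ' hsq' hlt j => (ih F Q' hQ' hsq' (by omega) j).1) i
    have h2 := sum_primitive_even_norm_charSum_pow_four_le (Q := Q) i
    have h3 := sum_primitive_odd_norm_charSum_pow_four_le (Q := Q) i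
    have hbad : ∑ χ : MulChar (AdjoinRoot Q) ℂ with
        χ ≠ 1 ∧ ¬(IsPrimitiveChar χ ∧ ¬IsEvenChar χ), ‖charSum χ i‖ ^ 4 =
        ∑ χ : MulChar (AdjoinRoot Q) ℂ with χ ≠ 1 ∧ ¬IsPrimitiveChar χ, ‖charSum χ i‖ ^ 4 +
        ∑ χ : MulChar (AdjoinRoot Q) ℂ with χ ≠ 1 ∧ IsPrimitiveChar χ ∧ IsEvenChar χ,
          ‖charSum χ i‖ ^ 4 := by
      simp only [Finset.sum_filter, ← Finset.sum_add_distrib]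
      refine Finset.sum_congr rfl fun χ _ => ?_
      by_cases a : χ = 1 <;> by_cases b : IsPrimitiveChar χ <;> by_cases c : IsEvenChar χ <;>
        simp [a, b, c]
    have hall : ∑ χ : MulChar (AdjoinRoot Q) ℂ with χ ≠ 1, ‖charSum χ i‖ ^ 4 =
        ∑ χ : MulChar (AdjoinRoot Q) ℂ with
          χ ≠ 1 ∧ ¬(IsPrimitiveChar χ ∧ ¬IsEvenChar χ), ‖charSum χ i‖ ^ 4 +
        ∑ χ : MulChar (AdjoinRoot Q) ℂ with χ ≠ 1 ∧ IsPrimitiveChar χ ∧ ¬IsEvenChar χ,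
          ‖charSum χ i‖ ^ 4 := by
      simp only [Finset.sum_filter, ← Finset.sum_add_distrib]
      refine Finset.sum_congr rfl fun χ _ => ?_
      by_cases a : χ = 1 <;> by_cases b : IsPrimitiveChar χ <;> by_cases c : IsEvenChar χ <;>
        simp [a, b, c]
    have hB0 : 0 ≤ ∑ χ : MulChar (AdjoinRoot Q) ℂ with
        χ ≠ 1 ∧ ¬(IsPrimitiveChar χ ∧ ¬IsEvenChar χ), ‖charSum χ i‖ ^ 4 :=
      Finset.sum_nonneg fun _ _ => by positivity
    have hCX := mul_nonneg hC hX
    have hKX := mul_nonneg hK hX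
    have h4 := le_mul_of_one_le_left hB0 hq
    rw [hbad] at h4
    rw [hall, hbad]
    rw [mul_add] at h4 ⊢
    rw [heq] at h1 h2 h3 hCX hKX ⊢
    constructor <;> linarith

end FourthMoment

section SecondMoment

variable {F : Type} [Field F] [Fintype F]

/-- The sum of `d_2 χ` over monic polynomials of degree `n`. -/
noncomputable def pairSum {Q : F[X]} (χ : MulChar (AdjoinRoot Q) ℂ) (n : ℕ) : ℂ :=
  ∑ p ∈ antidiagonal n, charSum χ p.1 * charSum χ p.2

theorem pairSum_eq_sum_monicPairs {Q : F[X]} (χ : MulChar (AdjoinRoot Q) ℂ) (n : ℕ) :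
    pairSum χ n = ∑ p ∈ monicPairs F n, χ (AdjoinRoot.mk Q (p.1 * p.2)) := by
  rw [pairSum, sum_monicPairs]
  refine Finset.sum_congr rfl fun x _ => ?_
  rw [charSum_mul_charSum, Finset.sum_product]

/-- A fourth moment bound for `charSum` gives a second moment bound for `pairSum`. -/
theorem sum_norm_pairSum_sq_le {Q : F[X]} (T : Finset (MulChar (AdjoinRoot Q) ℂ)) {C : ℝ}
    (hT : ∀ i, Fintype.card F * ∑ χ ∈ T, ‖charSum χ i‖ ^ 4 ≤
      C * (Fintype.card F : ℝ) ^ (Q.natDegree + 2 * i)) (n : ℕ) :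
    Fintype.card F * ∑ χ ∈ T, ‖pairSum χ n‖ ^ 2 ≤
      (n + 1) ^ 2 * C * (Fintype.card F : ℝ) ^ (Q.natDegree + n) := by
  set q := (Fintype.card F : ℝ)
  have hq : 1 ≤ q := one_le_card_real F
  have hij (p : ℕ × ℕ) : q * ∑ χ ∈ T, ‖charSum χ p.1 * charSum χ p.2‖ ^ 2 ≤
      C * q ^ (Q.natDegree + (p.1 + p.2)) := by
    obtain ⟨i, j⟩ := p
    refine le_of_mul_le_mul_left ?_ (by positivity : 0 < 2 * q ^ (i + j))
    calc 2 * q ^ (i + j) * (q * ∑ χ ∈ T, ‖charSum χ i * charSum χ j‖ ^ 2)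
        = q * ∑ χ ∈ T, 2 * q ^ (i + j) * ‖charSum χ i * charSum χ j‖ ^ 2 := by
          rw [← Finset.mul_sum]
          ring
      _ ≤ q * ∑ χ ∈ T, (q ^ (2 * j) * ‖charSum χ i‖ ^ 4 + q ^ (2 * i) * ‖charSum χ j‖ ^ 4) := by
          gcongr with χ
          rw [norm_mul]
          have := sq_nonneg (q ^ j * ‖charSum χ i‖ ^ 2 - q ^ i * ‖charSum χ j‖ ^ 2)
          rw [pow_add, mul_comm 2 j, mul_comm 2 i, pow_mul, pow_mul]
          linarith
      _ = q ^ (2 * j) * (q * ∑ χ ∈ T, ‖charSum χ i‖ ^ 4) +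
            q ^ (2 * i) * (q * ∑ χ ∈ T, ‖charSum χ j‖ ^ 4) := by
          rw [Finset.sum_add_distrib, ← Finset.mul_sum, ← Finset.mul_sum]
          ring
      _ ≤ q ^ (2 * j) * (C * q ^ (Q.natDegree + 2 * i)) +
            q ^ (2 * i) * (C * q ^ (Q.natDegree + 2 * j)) :=
          add_le_add (mul_le_mul_of_nonneg_left (hT i) (by positivity))
            (mul_le_mul_of_nonneg_left (hT j) (by positivity))
      _ = _ := by ring
  calc q * ∑ χ ∈ T, ‖pairSum χ n‖ ^ 2
      ≤ q * ∑ χ ∈ T, (n + 1) * ∑ p ∈ antidiagonal n, ‖charSum χ p.1 * charSum χ p.2‖ ^ 2 := by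
        gcongr with χ
        refine (pow_le_pow_left₀ (norm_nonneg _) (norm_sum_le _ _) 2).trans
          (sq_sum_le_card_mul_sum_sq.trans (le_of_eq ?_))
        rw [Finset.Nat.card_antidiagonal]
        push_cast
        rfl
    _ = (n + 1) * ∑ p ∈ antidiagonal n, q * ∑ χ ∈ T, ‖charSum χ p.1 * charSum χ p.2‖ ^ 2 := by
        rw [← Finset.mul_sum, Finset.sum_comm, ← Finset.mul_sum]
        ring
    _ ≤ (n + 1) * ∑ p ∈ antidiagonal n, C * q ^ (Q.natDegree + n) := by
        refine mul_le_mul_of_nonneg_left (Finset.sum_le_sum fun p hp => ?_) (by positivity)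
        rw [← mem_antidiagonal.1 hp]
        exact hij p
    _ = _ := by
        rw [Finset.sum_const, Finset.Nat.card_antidiagonal, nsmul_eq_mul]
        push_cast
        ring

variable {Q : F[X]} [hQ : Fact Q.Monic]

theorem norm_pairSum_sq_le (χ : MulChar (AdjoinRoot Q) ℂ) (n : ℕ) :
    ‖pairSum χ n‖ ^ 2 ≤ (n + 1 : ℝ) ^ 2 * (Fintype.card F : ℝ) ^ (2 * n) := by
  have h : ‖pairSum χ n‖ ≤ (n + 1) * (Fintype.card F : ℝ) ^ n := by
    rw [pairSum_eq_sum_monicPairs]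
    refine (norm_sum_le_of_le _ fun p _ => MulChar.norm_apply_le_one χ _).trans (le_of_eq ?_)
    rw [Finset.sum_const, card_monicPairs, nsmul_eq_mul, mul_one]
    push_cast
    rfl
  refine (pow_le_pow_left₀ (norm_nonneg _) h 2).trans (le_of_eq ?_)
  ring

theorem sum_norm_pairSum_sq {m : ℕ} (hm : m ≤ Q.natDegree) :
    ∑ χ : MulChar (AdjoinRoot Q) ℂ, ‖pairSum χ m‖ ^ 2 = (Fintype.card (AdjoinRoot Q)ˣ : ℝ) *
      ∑ f ∈ monics F m with IsCoprime f Q, (dpoly F 2 f : ℝ) ^ 2 := by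
  simp_rw [pairSum_eq_sum_monicPairs]
  rw [MulChar.sum_norm_sum_sq]
  congr 1
  have h := card_coprime_solutions Q m
  rw [productSolutions, Finset.filter_filter] at h
  have h' : ((monicPairs F m ×ˢ monicPairs F m).filter fun w =>
      IsUnit (AdjoinRoot.mk Q (w.1.1 * w.1.2)) ∧
        AdjoinRoot.mk Q (w.1.1 * w.1.2) = AdjoinRoot.mk Q (w.2.1 * w.2.2)) =
      (monicPairs F m ×ˢ monicPairs F m).filter fun w =>
        w.1.1 * w.1.2 = w.2.1 * w.2.2 ∧ IsCoprime (w.1.1 * w.1.2) Q := by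
    refine Finset.filter_congr fun w hw => ?_
    rw [Finset.mem_product] at hw
    rw [AdjoinRoot.isUnit_mk_iff, and_comm, (injOn_mk_monics hQ.out hm).eq_iff
      (mul_mem_monics_of_mem_monicPairs hw.1) (mul_mem_monics_of_mem_monicPairs hw.2)]
  rw [h', h]
  push_cast
  rfl

theorem abs_sum_norm_pairSum_sq_sub_le {m : ℕ} (hm : m + 1 ≤ Q.natDegree) :
    (Fintype.card F : ℝ) * |∑ χ : MulChar (AdjoinRoot Q) ℂ with χ ≠ 1, ‖pairSum χ m‖ ^ 2 -
      Fintype.card (AdjoinRoot Q)ˣ * (quadrupleCount m * (Fintype.card F : ℝ) ^ m)| ≤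
      ((4 * Q.natDegree + m) * quadrupleCount m + (m + 1) ^ 2) *
        (Fintype.card F : ℝ) ^ (Q.natDegree + m) := by
  set q := (Fintype.card F : ℝ)
  have hq : 1 ≤ q := one_le_card_real F
  set Φ := (Fintype.card (AdjoinRoot Q)ˣ : ℝ)
  set D := ∑ f ∈ monics F m with IsCoprime f Q, (dpoly F 2 f : ℝ) ^ 2
  have h1 : ∑ χ : MulChar (AdjoinRoot Q) ℂ with χ ≠ 1, ‖pairSum χ m‖ ^ 2 =
      Φ * D - ‖pairSum (1 : MulChar (AdjoinRoot Q) ℂ) m‖ ^ 2 := by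
    rw [← sum_norm_pairSum_sq (by omega), Finset.filter_ne',
      ← Finset.sum_erase_add _ _ (Finset.mem_univ (1 : MulChar (AdjoinRoot Q) ℂ)),
      add_sub_cancel_right]
  have h2 : q * ‖pairSum (1 : MulChar (AdjoinRoot Q) ℂ) m‖ ^ 2 ≤
      (m + 1) ^ 2 * q ^ (Q.natDegree + m) := by
    refine (mul_le_mul_of_nonneg_left (norm_pairSum_sq_le _ m) (by positivity)).trans ?_
    rw [mul_left_comm, ← pow_succ']
    exact mul_le_mul_of_nonneg_left (pow_le_pow_right₀ hq (by omega)) (by positivity)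
  have h3 : q * |D - quadrupleCount m * q ^ m| ≤
      (4 * Q.natDegree + m) * quadrupleCount m * q ^ m := abs_sum_dpoly_sq_sub_le hQ.out m
  rw [h1]
  calc q * |Φ * D - ‖pairSum (1 : MulChar (AdjoinRoot Q) ℂ) m‖ ^ 2 -
        Φ * (quadrupleCount m * q ^ m)|
      = q * |Φ * (D - quadrupleCount m * q ^ m) -
          ‖pairSum (1 : MulChar (AdjoinRoot Q) ℂ) m‖ ^ 2| := by
        congr 2
        ring
    _ ≤ q * (Φ * |D - quadrupleCount m * q ^ m| +
          ‖pairSum (1 : MulChar (AdjoinRoot Q) ℂ) m‖ ^ 2) := by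
        gcongr
        refine (abs_sub _ _).trans (le_of_eq ?_)
        rw [abs_mul, abs_of_nonneg (by positivity : 0 ≤ Φ), abs_of_nonneg (by positivity :
          0 ≤ ‖pairSum (1 : MulChar (AdjoinRoot Q) ℂ) m‖ ^ 2)]
    _ = Φ * (q * |D - quadrupleCount m * q ^ m|) +
          q * ‖pairSum (1 : MulChar (AdjoinRoot Q) ℂ) m‖ ^ 2 := by ring
    _ ≤ q ^ Q.natDegree * ((4 * Q.natDegree + m) * quadrupleCount m * q ^ m) +
          (m + 1) ^ 2 * q ^ (Q.natDegree + m) := by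
        gcongr
        exact card_units_le
    _ = _ := by ring

/-- The functional equation for `pairSum`. -/
theorem IsPrimitiveChar.norm_pairSum_sq {χ : MulChar (AdjoinRoot Q) ℂ} (h1 : χ ≠ 1)
    (hχ : IsPrimitiveChar χ) (ho : ¬IsEvenChar χ) {m n : ℕ} (hm : m + 1 ≤ Q.natDegree)
    (hmn : m + n + 2 = 2 * Q.natDegree) :
    (Fintype.card F : ℝ) ^ m * ‖pairSum χ n‖ ^ 2 =
      (Fintype.card F : ℝ) ^ n * ‖pairSum χ m‖ ^ 2 := by
  obtain ⟨ψ, hψ⟩ := exists_addChar_ne_one F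
  set q := (Fintype.card F : ℝ)
  have hq : 1 ≤ q := one_le_card_real F
  have hc : constChar χ ≠ 1 := fun h => ho (constChar_eq_one_iff.1 h)
  set G := gaussSum χ (residueAddChar Q ψ) * conj (gaussSum (constChar χ) ψ)
  have hG : ‖G‖ ^ 2 = q ^ (Q.natDegree + 1) := by
    rw [norm_mul, RCLike.norm_conj, mul_pow, hχ.norm_gaussSum_residueAddChar_sq hψ,
      norm_gaussSum_sq hc hψ, pow_succ]
  have hfe {k : ℕ} (hk : k < Q.natDegree) : (Fintype.card F : ℂ) ^ (k + 1) *
      charSum χ (Q.natDegree - 1 - k) = G * conj (charSum χ k) := by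
    have h := hχ.pow_mul_charSum_eq hψ (i := Q.natDegree - 1 - k) (by omega)
    rw [sum_apply_const, if_neg ho, zero_mul, add_zero, map_mul, ← mul_assoc,
      (by omega : Q.natDegree - (Q.natDegree - 1 - k) = k + 1),
      (by omega : Q.natDegree - 1 - (Q.natDegree - 1 - k) = k)] at h
    exact h
  have hre : pairSum χ n = ∑ p ∈ antidiagonal m,
      charSum χ (Q.natDegree - 1 - p.1) * charSum χ (Q.natDegree - 1 - p.2) := by
    symm
    refine Finset.sum_of_injOn (fun p => (Q.natDegree - 1 - p.1, Q.natDegree - 1 - p.2))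
      ?_ ?_ ?_ fun _ _ => rfl
    · rintro ⟨a, b⟩ ha ⟨a', b'⟩ ha' h
      simp only [Finset.mem_coe, mem_antidiagonal, Prod.mk.injEq] at ha ha' h ⊢
      omega
    · rintro ⟨a, b⟩ ha
      simp only [Finset.mem_coe, mem_antidiagonal] at ha ⊢
      omega
    · rintro ⟨a, b⟩ ha hi
      rw [mem_antidiagonal] at ha
      simp only at ha ⊢
      by_cases hd : Q.natDegree ≤ a
      · rw [charSum_eq_zero h1 hd, zero_mul]
      by_cases hd' : Q.natDegree ≤ b
      · rw [charSum_eq_zero h1 hd', mul_zero]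
      refine absurd ⟨(Q.natDegree - 1 - a, Q.natDegree - 1 - b), ?_, ?_⟩ hi
      · rw [Finset.mem_coe, mem_antidiagonal]
        simp only
        omega
      · simp only [Prod.mk.injEq]
        omega
  have hmain : (Fintype.card F : ℂ) ^ (m + 2) * pairSum χ n = G ^ 2 * conj (pairSum χ m) := by
    rw [hre, pairSum, map_sum, Finset.mul_sum, Finset.mul_sum]
    refine Finset.sum_congr rfl fun p hp => ?_
    rw [mem_antidiagonal] at hp
    rw [← hp, map_mul]
    calc _ = ((Fintype.card F : ℂ) ^ (p.1 + 1) * charSum χ (Q.natDegree - 1 - p.1)) *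
          ((Fintype.card F : ℂ) ^ (p.2 + 1) * charSum χ (Q.natDegree - 1 - p.2)) := by ring
      _ = _ := by
        rw [hfe (by omega), hfe (by omega)]
        ring
  have hnorm := congrArg (fun z => ‖z‖ ^ 2) hmain
  simp only [norm_mul, norm_pow, RCLike.norm_conj, Complex.norm_natCast, mul_pow] at hnorm
  change (q ^ (m + 2)) ^ 2 * _ = _ at hnorm
  rw [hG] at hnorm
  refine mul_left_cancel₀ (by positivity : q ^ (m + 4) ≠ 0) ?_
  calc q ^ (m + 4) * (q ^ m * ‖pairSum χ n‖ ^ 2) = (q ^ (m + 2)) ^ 2 * ‖pairSum χ n‖ ^ 2 := by ring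
    _ = (q ^ (Q.natDegree + 1)) ^ 2 * ‖pairSum χ m‖ ^ 2 := hnorm
    _ = q ^ (m + 4) * (q ^ n * ‖pairSum χ m‖ ^ 2) := by
      rw [← mul_assoc, ← pow_add, ← pow_mul]
      congr 2
      omega

end SecondMoment

/-- The exponent whose value of `Pol3` is the limiting variance. -/
def limitIndex (d n : ℕ) : ℕ := if n ≤ d - 1 then n else 2 * (d - 1) - n

theorem exists_second_moment_bound {d n : ℕ} (hd : 2 ≤ d) (hn : n ≤ 2 * (d - 1)) :
    ∃ C : ℝ, 0 ≤ C ∧ ∀ (F : Type) [Field F] [Fintype F] (Q : F[X]) (_ : Fact Q.Monic),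
      Squarefree Q → Q.natDegree = d →
        (Fintype.card F : ℝ) * |∑ χ : MulChar (AdjoinRoot Q) ℂ with χ ≠ 1, ‖pairSum χ n‖ ^ 2 -
          Fintype.card (AdjoinRoot Q)ˣ *
            (quadrupleCount (limitIndex d n) * (Fintype.card F : ℝ) ^ n)| ≤
          C * (Fintype.card F : ℝ) ^ (d + n) := by
  unfold limitIndex
  split_ifs with hnd
  · refine ⟨(4 * d + n) * quadrupleCount n + (n + 1) ^ 2, by positivity,
      fun F _ _ Q _ _ hQd => ?_⟩
    subst hQd
    exact abs_sum_norm_pairSum_sq_sub_le (by omega)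
  obtain ⟨m, hm⟩ : ∃ m, m = 2 * (d - 1) - n := ⟨_, rfl⟩
  rw [← hm]
  obtain ⟨C, hC, hfour⟩ := exists_fourth_moment_bound d
  refine ⟨(n + 1) ^ 2 * C + (m + 1) ^ 2 * C + ((4 * d + m) * quadrupleCount m + (m + 1) ^ 2),
    by positivity, fun F _ _ Q hQ hsq hQd => ?_⟩
  have hbad := fun i => (hfour F Q hQ hsq hQd.le i).2
  have hbm := sum_norm_pairSum_sq_le _ hbad m
  have hbn := sum_norm_pairSum_sq_le _ hbad n
  have hm1 := abs_sum_norm_pairSum_sq_sub_le (Q := Q) (m := m) (by omega)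
  have hsplit (k : ℕ) : ∑ χ : MulChar (AdjoinRoot Q) ℂ with χ ≠ 1, ‖pairSum χ k‖ ^ 2 =
      ∑ χ : MulChar (AdjoinRoot Q) ℂ with
        χ ≠ 1 ∧ ¬(IsPrimitiveChar χ ∧ ¬IsEvenChar χ), ‖pairSum χ k‖ ^ 2 +
      ∑ χ : MulChar (AdjoinRoot Q) ℂ with χ ≠ 1 ∧ IsPrimitiveChar χ ∧ ¬IsEvenChar χ,
        ‖pairSum χ k‖ ^ 2 := by
    simp only [Finset.sum_filter, ← Finset.sum_add_distrib]
    refine Finset.sum_congr rfl fun χ _ => ?_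
    by_cases a : χ = 1 <;> by_cases b : IsPrimitiveChar χ <;> by_cases c : IsEvenChar χ <;>
      simp [a, b, c]
  have hfe : (Fintype.card F : ℝ) ^ m * ∑ χ : MulChar (AdjoinRoot Q) ℂ with
      χ ≠ 1 ∧ IsPrimitiveChar χ ∧ ¬IsEvenChar χ, ‖pairSum χ n‖ ^ 2 =
      (Fintype.card F : ℝ) ^ n * ∑ χ : MulChar (AdjoinRoot Q) ℂ with
        χ ≠ 1 ∧ IsPrimitiveChar χ ∧ ¬IsEvenChar χ, ‖pairSum χ m‖ ^ 2 := by
    rw [Finset.mul_sum, Finset.mul_sum]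
    refine Finset.sum_congr rfl fun χ hχ => ?_
    obtain ⟨-, h1, hp, ho⟩ := Finset.mem_filter.1 hχ
    exact hp.norm_pairSum_sq h1 ho (by omega) (by omega)
  rw [hsplit] at hm1 ⊢
  have hBn : 0 ≤ ∑ χ : MulChar (AdjoinRoot Q) ℂ with
      χ ≠ 1 ∧ ¬(IsPrimitiveChar χ ∧ ¬IsEvenChar χ), ‖pairSum χ n‖ ^ 2 :=
    Finset.sum_nonneg fun _ _ => by positivity
  have hBm : 0 ≤ ∑ χ : MulChar (AdjoinRoot Q) ℂ with
      χ ≠ 1 ∧ ¬(IsPrimitiveChar χ ∧ ¬IsEvenChar χ), ‖pairSum χ m‖ ^ 2 :=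
    Finset.sum_nonneg fun _ _ => by positivity
  have hq : (1 : ℝ) ≤ Fintype.card F := one_le_card_real F
  rw [hQd] at hbm hbn hm1
  generalize (∑ χ : MulChar (AdjoinRoot Q) ℂ with
      χ ≠ 1 ∧ ¬(IsPrimitiveChar χ ∧ ¬IsEvenChar χ), ‖pairSum χ n‖ ^ 2) = Bn at *
  generalize (∑ χ : MulChar (AdjoinRoot Q) ℂ with
      χ ≠ 1 ∧ ¬(IsPrimitiveChar χ ∧ ¬IsEvenChar χ), ‖pairSum χ m‖ ^ 2) = Bm at *
  generalize (∑ χ : MulChar (AdjoinRoot Q) ℂ with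
      χ ≠ 1 ∧ IsPrimitiveChar χ ∧ ¬IsEvenChar χ, ‖pairSum χ n‖ ^ 2) = Gn at *
  generalize (∑ χ : MulChar (AdjoinRoot Q) ℂ with
      χ ≠ 1 ∧ IsPrimitiveChar χ ∧ ¬IsEvenChar χ, ‖pairSum χ m‖ ^ 2) = Gm at *
  generalize (Fintype.card F : ℝ) = q at *
  generalize (Fintype.card (AdjoinRoot Q)ˣ : ℝ) = Φ at *
  set L := (quadrupleCount m : ℝ)
  have hqm : 0 < q ^ m := by positivity
  have hG : q * |Gm - Φ * (L * q ^ m)| ≤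
      ((m + 1) ^ 2 * C + ((4 * d + m) * L + (m + 1) ^ 2)) * q ^ (d + m) := by
    calc q * |Gm - Φ * (L * q ^ m)| = q * |(Bm + Gm - Φ * (L * q ^ m)) - Bm| := by
          congr 2
          ring
      _ ≤ q * (|Bm + Gm - Φ * (L * q ^ m)| + Bm) := by
          gcongr
          exact (abs_sub _ _).trans (by rw [abs_of_nonneg hBm])
      _ ≤ _ := by linarith
  have hGn : q * |Gn - Φ * (L * q ^ n)| ≤
      ((m + 1) ^ 2 * C + ((4 * d + m) * L + (m + 1) ^ 2)) * q ^ (d + n) := by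
    refine le_of_mul_le_mul_left ?_ hqm
    calc q ^ m * (q * |Gn - Φ * (L * q ^ n)|) = q * |q ^ m * (Gn - Φ * (L * q ^ n))| := by
          rw [abs_mul, abs_of_pos hqm]
          ring
      _ = q * |q ^ n * (Gm - Φ * (L * q ^ m))| := by
          rw [mul_sub, hfe]
          congr 2
          ring
      _ = q ^ n * (q * |Gm - Φ * (L * q ^ m)|) := by
          rw [abs_mul, abs_of_pos (by positivity : 0 < q ^ n)]
          ring
      _ ≤ q ^ n * (((m + 1) ^ 2 * C + ((4 * d + m) * L + (m + 1) ^ 2)) * q ^ (d + m)) := by gcongr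
      _ = _ := by ring
  calc q * |Bn + Gn - Φ * (L * q ^ n)| = q * |Bn + (Gn - Φ * (L * q ^ n))| := by
        congr 2
        ring
    _ ≤ q * (Bn + |Gn - Φ * (L * q ^ n)|) := by
        gcongr
        exact (abs_add_le _ _).trans (by rw [abs_of_nonneg hBn])
    _ ≤ _ := by linarith

section Variance

variable {F : Type} [Field F] [Fintype F]

/-- The sum of `d_2` over the monic polynomials of degree `n` in a residue class. -/
noncomputable def classSum {Q : F[X]} (n : ℕ) (x : AdjoinRoot Q) : ℝ :=
  ∑ f ∈ monics F n with AdjoinRoot.mk Q f = x, (dpoly F 2 f : ℝ)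

theorem Sap_eq_classSum (n : ℕ) (Q A : F[X]) : Sap F 2 n Q A = classSum n (AdjoinRoot.mk Q A) := by
  rw [Sap, classSum, Finset.sum_filter, Finset.sum_filter, sum_monics]
  simp_rw [AdjoinRoot.mk_eq_mk]

variable {Q : F[X]} [hQ : Fact Q.Monic]

theorem sum_classSum_mul (χ : MulChar (AdjoinRoot Q) ℂ) (n : ℕ) :
    ∑ x, (classSum n x : ℂ) * χ x = pairSum χ n := by
  have h1 : ∑ x, (classSum n x : ℂ) * χ x =
      ∑ f ∈ monics F n, (dpoly F 2 f : ℂ) * χ (AdjoinRoot.mk Q f) := by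
    rw [← Finset.sum_fiberwise (monics F n) (AdjoinRoot.mk Q)]
    refine Finset.sum_congr rfl fun x _ => ?_
    rw [classSum, Complex.ofReal_sum, Finset.sum_mul]
    refine Finset.sum_congr rfl fun f hf => ?_
    rw [(Finset.mem_filter.1 hf).2, Complex.ofReal_natCast]
  have h2 := Finset.sum_fiberwise_of_maps_to (s := monicPairs F n) (t := monics F n)
    (g := fun p => p.1 * p.2) (fun p hp => mul_mem_monics_of_mem_monicPairs hp)
    fun p => χ (AdjoinRoot.mk Q (p.1 * p.2))
  rw [h1, pairSum_eq_sum_monicPairs, ← h2]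
  refine Finset.sum_congr rfl fun f hf => ?_
  rw [Finset.sum_congr rfl fun p hp => by rw [(Finset.mem_filter.1 hp).2], Finset.sum_const,
    dpoly_two_eq_card hf, nsmul_eq_mul]

theorem sum_residues {M : Type*} [AddCommMonoid M] (g : AdjoinRoot Q → M) :
    ∑ b ∈ residues F Q.natDegree Q, g (AdjoinRoot.mk Q (resPoly F Q.natDegree b)) =
      ∑ x with IsUnit x, g x := by
  rw [residues, Finset.sum_filter, Finset.sum_filter, ← sum_lowDegree_mk, lowDegree,
    Finset.sum_image fun _ _ _ _ h => resPoly_injective _ h]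
  simp_rw [AdjoinRoot.isUnit_mk_iff]

variable (Q) in
theorem card_residues : (residues F Q.natDegree Q).card = Fintype.card (AdjoinRoot Q)ˣ := by
  rw [← card_filter_isUnit, Finset.card_eq_sum_ones, Finset.card_eq_sum_ones]
  exact sum_residues fun _ => 1

variable (Q) in
theorem card_sq_mul_VarAP (n : ℕ) :
    (Fintype.card (AdjoinRoot Q)ˣ : ℝ) ^ 2 * VarAP F 2 n Q.natDegree Q =
      ∑ χ : MulChar (AdjoinRoot Q) ℂ with χ ≠ 1, ‖pairSum χ n‖ ^ 2 := by
  have hΦ : (Fintype.card (AdjoinRoot Q)ˣ : ℝ) ≠ 0 := Nat.cast_ne_zero.2 Fintype.card_ne_zero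
  have hpar := MulChar.sum_norm_transform_sq (R := AdjoinRoot Q) (classSum n)
  simp_rw [sum_classSum_mul] at hpar
  have hone : pairSum (1 : MulChar (AdjoinRoot Q) ℂ) n =
      ((∑ x : AdjoinRoot Q with IsUnit x, classSum n x : ℝ) : ℂ) := by
    rw [← sum_classSum_mul, Finset.sum_filter, Complex.ofReal_sum]
    refine Finset.sum_congr rfl fun x _ => ?_
    split_ifs with hx
    · rw [MulChar.one_apply hx, mul_one]
    · rw [MulChar.map_nonunit _ hx, mul_zero, Complex.ofReal_zero]
  have hmean : meanSap F 2 n Q.natDegree Q = 1 / (Fintype.card (AdjoinRoot Q)ˣ : ℝ) *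
      ∑ x : AdjoinRoot Q with IsUnit x, classSum n x := by
    rw [meanSap, card_residues]
    simp_rw [Sap_eq_classSum]
    rw [sum_residues (classSum n)]
  rw [Finset.filter_ne', ← add_left_inj (‖pairSum (1 : MulChar (AdjoinRoot Q) ℂ) n‖ ^ 2),
    Finset.sum_erase_add _ _ (Finset.mem_univ (1 : MulChar (AdjoinRoot Q) ℂ)), hpar, hone,
    Complex.norm_real, Real.norm_eq_abs, sq_abs, VarAP, card_residues]
  simp_rw [Sap_eq_classSum]
  rw [sum_residues fun x => (classSum n x - meanSap F 2 n Q.natDegree Q) ^ 2, hmean]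
  simp_rw [sub_sq, Finset.sum_add_distrib, Finset.sum_sub_distrib, ← Finset.sum_mul,
    ← Finset.mul_sum, Finset.sum_const, card_filter_isUnit, nsmul_eq_mul]
  field_simp
  ring

variable (Q) in
theorem card_mul_sub_card_units_le :
    (Fintype.card F : ℝ) * ((Fintype.card F : ℝ) ^ Q.natDegree - Fintype.card (AdjoinRoot Q)ˣ) ≤
      Q.natDegree * (Fintype.card F : ℝ) ^ Q.natDegree := by
  have h1 : ((monics F Q.natDegree).filter fun f => IsCoprime f Q).card =
      Fintype.card (AdjoinRoot Q)ˣ := by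
    rw [← card_filter_isUnit, Finset.card_filter, Finset.card_filter, ← sum_monics_mk]
    simp_rw [AdjoinRoot.isUnit_mk_iff]
  have h2 := Finset.card_filter_add_card_filter_not (s := monics F Q.natDegree)
    fun f => IsCoprime f Q
  rw [h1, card_monics] at h2
  have h3 := card_mul_card_not_isCoprime_le hQ.out Q.natDegree
  have h2' := congrArg (Nat.cast (R := ℝ)) h2
  have h3' := (Nat.cast_le (α := ℝ)).2 h3
  push_cast at h2' h3'
  rw [← h2', add_sub_cancel_left, h2']
  exact h3'

end Variance

theorem cast_quadrupleCount (m : ℕ) : (quadrupleCount m : ℝ) = Pol3 m := by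
  have h := congrArg (Nat.cast (R := ℝ)) (sum_antidiagonal_succ_mul_succ m)
  rw [← quadrupleCount] at h
  push_cast at h
  rw [Pol3]
  linarith

/-- From the second moment to the normalized variance. -/
theorem abs_sub_le_of_second_moment {q Φ v L C e X : ℝ} (hq : 0 < q) (hX : 0 < X) (hL : 0 ≤ L)
    (hΦ : Φ ≤ X) (hΦ' : q * (X - Φ) ≤ e * X) (hqe : 2 * e ≤ q)
    (h : q * |Φ ^ 2 * v - Φ * (L * X)| ≤ C * X ^ 2) :
    q * |v - L| ≤ 4 * C + 4 * L * e := by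
  have hhalf : X ≤ 2 * Φ := by
    refine le_of_mul_le_mul_left ?_ hq
    nlinarith
  have hΦ0 : 0 < Φ := by linarith
  have h1 : X ^ 2 * |v - L| ≤ 4 * |Φ ^ 2 * v - Φ * (L * X)| + 4 * L * X * (X - Φ) := by
    have hA : Φ ^ 2 * |v - L| ≤ |Φ ^ 2 * v - Φ * (L * X)| + Φ * L * (X - Φ) := by
      have e1 : Φ ^ 2 * (v - L) = (Φ ^ 2 * v - Φ * (L * X)) + Φ * L * (X - Φ) := by ring
      rw [← abs_of_nonneg (sq_nonneg Φ), ← abs_mul, abs_of_nonneg (sq_nonneg Φ), e1]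
      refine (abs_add_le _ _).trans ?_
      rw [abs_of_nonneg (mul_nonneg (mul_nonneg hΦ0.le hL) (sub_nonneg.2 hΦ))]
    have hsq : X ^ 2 ≤ 4 * Φ ^ 2 := by nlinarith
    have hX2 : X ^ 2 * |v - L| ≤ 4 * Φ ^ 2 * |v - L| :=
      mul_le_mul_of_nonneg_right hsq (abs_nonneg _)
    have hΦX : Φ * L * (X - Φ) ≤ X * L * (X - Φ) := by
      gcongr
    linarith
  refine le_of_mul_le_mul_left ?_ (by positivity : 0 < X ^ 2)
  have h2 := mul_le_mul_of_nonneg_left h1 hq.le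
  have h3 := mul_le_mul_of_nonneg_left hΦ' (by positivity : 0 ≤ 4 * L * X)
  linarith

theorem variance_divisor_arithmetic_progressions (d n : ℕ) (hd : 2 ≤ d)
    (hn2 : 2 ≤ n) (hn : n ≤ 2 * (d - 1)) :
    ∀ ε : ℝ, 0 < ε → ∃ Q₀ : ℕ, ∀ q : ℕ, Q₀ ≤ q → IsPrimePow q →
      ∀ (F : Type) [Field F] [Fintype F], Fintype.card F = q →
        ∀ Q : Polynomial F, Squarefree Q → Q.Monic → Q.natDegree = d →
          |VarAP F 2 n d Q / ((q : ℝ) ^ n / (q : ℝ) ^ d)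
              - (if n ≤ d - 1 then Pol3 (n : ℝ) else Pol3 ((2 * (d - 1) - n : ℕ) : ℝ))| < ε := by
  intro ε hε
  obtain ⟨C, hC, hmom⟩ := exists_second_moment_bound hd hn
  have hlim : (if n ≤ d - 1 then Pol3 (n : ℝ) else Pol3 ((2 * (d - 1) - n : ℕ) : ℝ)) =
      (quadrupleCount (limitIndex d n) : ℝ) := by
    rw [cast_quadrupleCount, limitIndex]
    split_ifs <;> rfl
  rw [hlim]
  set L := (quadrupleCount (limitIndex d n) : ℝ)
  have hL : 0 ≤ L := Nat.cast_nonneg _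
  obtain ⟨N, hN⟩ := exists_nat_gt ((4 * C + 4 * L * d) / ε)
  refine ⟨max N (2 * d), fun q hq _ F _ _ hF Q hsq hQ hQd => ?_⟩
  have : Fact Q.Monic := ⟨hQ⟩
  have hq0 : (0 : ℝ) < q := by exact_mod_cast (by omega : 0 < q)
  have h := hmom F Q this hsq hQd
  rw [← card_sq_mul_VarAP, hF] at h
  have hΦ := card_units_le (Q := Q)
  have hΦ' := card_mul_sub_card_units_le Q
  rw [hF] at hΦ hΦ'
  subst hQd
  have hqn : (0 : ℝ) < (q : ℝ) ^ n := by positivity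
  have hqd : (0 : ℝ) < (q : ℝ) ^ Q.natDegree := by positivity
  have key := abs_sub_le_of_second_moment (C := C)
    (v := VarAP F 2 n Q.natDegree Q / ((q : ℝ) ^ n / (q : ℝ) ^ Q.natDegree))
    hq0 hqd hL hΦ hΦ' (by exact_mod_cast (le_max_right _ _).trans hq) (by
      refine le_of_mul_le_mul_left ?_ hqn
      have e : (q : ℝ) ^ n * ((Fintype.card (AdjoinRoot Q)ˣ : ℝ) ^ 2 *
          (VarAP F 2 n Q.natDegree Q / ((q : ℝ) ^ n / (q : ℝ) ^ Q.natDegree)) -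
          Fintype.card (AdjoinRoot Q)ˣ * (L * (q : ℝ) ^ Q.natDegree)) =
          (q : ℝ) ^ Q.natDegree * ((Fintype.card (AdjoinRoot Q)ˣ : ℝ) ^ 2 *
            VarAP F 2 n Q.natDegree Q - Fintype.card (AdjoinRoot Q)ˣ * (L * (q : ℝ) ^ n)) := by
        field_simp
      rw [mul_left_comm, ← abs_of_pos hqn, ← abs_mul, abs_of_pos hqn, e, abs_mul, abs_of_pos hqd,
        mul_left_comm]
      refine (mul_le_mul_of_nonneg_left h hqd.le).trans (le_of_eq ?_)
      ring)
  have hNq : (N : ℝ) ≤ q := by exact_mod_cast (le_max_left _ _).trans hq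
  rw [div_lt_iff₀ hε] at hN
  refine lt_of_mul_lt_mul_left (key.trans_lt (hN.trans_le ?_)) hq0.le
  gcongr
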